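/- If the Riemann hypothesis holds, then Li(θ(x)) ≤ Li(ψ(x)) for all x ≥ 2, and consequently Li(ψ(x)) − π(x) > 0 for all sufficiently large real x, where θ and ψ are the first and second Chebyshev functions, π is the prime counting function, and Li(y) = ∫₂^y dt / log t. -/

import Mathlib

open Filter

/-- The first Chebyshev function θ(x) = Σ_{p ≤ x, p prime} log p. -/
noncomputable def chebyshevTheta (x : ℝ) : ℝ :=
  ∑ p ∈ (Finset.Iic ⌊x⌋₊).filter Nat.Prime, Real.log p

/-- The second Chebyshev function ψ(x) = Σ_{n ≤ x} Λ(n). -/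
noncomputable def chebyshevPsi (x : ℝ) : ℝ :=
  ∑ n ∈ Finset.Icc 1 ⌊x⌋₊, ArithmeticFunction.vonMangoldt n

/-- The prime counting function π(x), the number of primes ≤ x. -/
noncomputable def primePi (x : ℝ) : ℕ := Nat.primeCounting ⌊x⌋₊

/-- The offset logarithmic integral Li(y) = ∫₂^y dt / log t. -/
noncomputable def Li (y : ℝ) : ℝ := ∫ t in (2 : ℝ)..y, 1 / Real.log t

section

open MeasureTheory Set Topology

/-- The truncated sawtooth function whose Mellin transform continues `ζ` to `0 < Re s`. -/
noncomputable def sawtooth (t : ℝ) : ℂ := (Ioi (1 : ℝ)).indicator (fun t => ((Int.fract t : ℝ) : ℂ)) t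

lemma norm_sawtooth_le (t : ℝ) : ‖sawtooth t‖ ≤ 1 := by
  unfold sawtooth indicator
  split_ifs
  · rw [Complex.norm_real, Real.norm_eq_abs, Int.abs_fract]
    exact (Int.fract_lt_one t).le
  · simp

lemma measurable_sawtooth : Measurable sawtooth :=
  (Complex.measurable_ofReal.comp measurable_fract).indicator measurableSet_Ioi

lemma mellin_sawtooth_eq (s : ℂ) :
    mellin sawtooth (-s) = ∫ t in Ioi (1 : ℝ), ((Int.fract t : ℝ) : ℂ) * (t : ℂ) ^ (-(s + 1)) := by
  unfold mellin sawtooth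
  have h : ∀ t : ℝ, (t : ℂ) ^ (-s - 1) • (Ioi (1 : ℝ)).indicator (fun t => ((Int.fract t : ℝ) : ℂ)) t =
      (Ioi (1 : ℝ)).indicator (fun t : ℝ => ((Int.fract t : ℝ) : ℂ) * (t : ℂ) ^ (-(s + 1))) t := by
    intro t
    by_cases ht : t ∈ Ioi (1 : ℝ)
    · simp only [indicator_of_mem ht, smul_eq_mul]
      rw [mul_comm]; congr 2; ring
    · simp only [indicator_of_notMem ht, smul_zero]
  simp_rw [h]
  rw [setIntegral_indicator measurableSet_Ioi]
  congr 2
  ext t; simp only [mem_inter_iff, mem_Ioi]; constructor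
  · exact fun h => h.2
  · exact fun h => ⟨by linarith, h⟩

lemma norm_mellin_sawtooth_le {s : ℂ} (hs : 0 < s.re) : ‖mellin sawtooth (-s)‖ ≤ 1 / s.re := by
  rw [mellin_sawtooth_eq]
  have h1 : ∫ t in Ioi (1 : ℝ), t ^ (-(s.re + 1)) = 1 / s.re := by
    rw [integral_Ioi_rpow_of_lt (by linarith) one_pos]
    simp
  rw [← h1]
  refine norm_integral_le_of_norm_le (integrableOn_Ioi_rpow_of_lt (by linarith) one_pos) ?_
  refine (ae_restrict_mem measurableSet_Ioi).mono fun t ht => ?_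
  have ht0 : (0 : ℝ) < t := lt_trans one_pos ht
  rw [norm_mul, Complex.norm_cpow_eq_rpow_re_of_pos ht0, Complex.norm_real, Real.norm_eq_abs,
    Int.abs_fract]
  simp only [Complex.neg_re, Complex.add_re, Complex.one_re]
  exact mul_le_of_le_one_left (by positivity) (Int.fract_lt_one t).le

lemma differentiableAt_mellin_sawtooth {s : ℂ} (hs : 0 < s.re) :
    DifferentiableAt ℂ (fun s => mellin sawtooth (-s)) s := by
  have : DifferentiableAt ℂ (mellin sawtooth) (-s) := by
    refine mellin_differentiableAt_of_isBigO_rpow (a := 0) (b := -s.re - 1) ?_ ?_ (by simpa) ?_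
      (by simp)
    · have : LocallyIntegrable sawtooth := by
        refine (locallyIntegrable_const (1 : ℝ)).mono measurable_sawtooth.aestronglyMeasurable ?_
        exact Eventually.of_forall fun t => by simpa using norm_sawtooth_le t
      exact this.locallyIntegrableOn _
    · refine Asymptotics.IsBigO.of_bound 1 (Eventually.of_forall fun t => ?_)
      simpa using norm_sawtooth_le t
    · refine Asymptotics.IsBigO.of_bound 1 ?_
      filter_upwards [mem_nhdsWithin_of_mem_nhds (Iio_mem_nhds (zero_lt_one (α := ℝ)))] with t ht
      simp only [mem_Iio] at ht
      have : sawtooth t = 0 := by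
        unfold sawtooth
        rw [indicator_of_notMem]
        simp [ht.le]
      rw [this, norm_zero]; positivity
  exact this.comp s differentiable_neg.differentiableAt

lemma riemannZeta₁_eq_of_one_lt_re {s : ℂ} (hs : 1 < s.re) :
    riemannZeta₁ s = s - s * (s - 1) * mellin sawtooth (-s) := by
  have hs1 : s ≠ 1 := by rintro rfl; simp at hs
  have hs0 : s - 1 ≠ 0 := sub_ne_zero.2 hs1
  have h1 : LSeries (fun n => ((1 : ℝ) : ℂ)) s = s * ∫ t in Ioi (1 : ℝ),
      (∑ k ∈ Finset.Icc 1 ⌊t⌋₊, (((1 : ℝ)) : ℂ)) * (t : ℂ) ^ (-(s + 1)) := by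
    refine LSeries_eq_mul_integral_of_nonneg (fun _ => 1) (r := 1) zero_le_one hs ?_ (by simp)
    refine Asymptotics.IsBigO.of_bound 1 (Eventually.of_forall fun n => ?_)
    simp
  have h2 : LSeries (fun n => ((1 : ℝ) : ℂ)) s = riemannZeta s := by
    rw [← LSeries_one_eq_riemannZeta hs]; congr 1
  have hI : ∀ a : ℂ, a.re < -1 → IntegrableOn (fun t : ℝ => (t : ℂ) ^ a) (Ioi 1) :=
    fun a ha => integrableOn_Ioi_cpow_of_lt ha one_pos
  have h3 : ∫ t in Ioi (1 : ℝ),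
      (∑ k ∈ Finset.Icc 1 ⌊t⌋₊, (((1 : ℝ)) : ℂ)) * (t : ℂ) ^ (-(s + 1)) =
      ∫ t in Ioi (1 : ℝ), ((t : ℂ) ^ (-s) - ((Int.fract t : ℝ) : ℂ) * (t : ℂ) ^ (-(s + 1))) := by
    refine setIntegral_congr_fun measurableSet_Ioi fun t ht => ?_
    have ht0 : (0 : ℝ) < t := lt_trans one_pos ht
    have e1 : (t : ℂ) ^ (-s) = t * (t : ℂ) ^ (-(s + 1)) := by
      have ht' : (t : ℂ) ≠ 0 := by exact_mod_cast ht0.ne'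
      rw [show -s = 1 + -(s + 1) by ring, Complex.cpow_add _ _ ht', Complex.cpow_one]
    have e2 : ((⌊t⌋₊ : ℝ)) = t - Int.fract t := by
      rw [natCast_floor_eq_intCast_floor ht0.le]; linarith [Int.floor_add_fract t]
    have e3 : ((⌊t⌋₊ : ℂ)) = t - ((Int.fract t : ℝ) : ℂ) := by exact_mod_cast congrArg Complex.ofReal e2
    simp only [Finset.sum_const, Nat.card_Icc, Complex.ofReal_one, nsmul_eq_mul, mul_one,
      Nat.add_sub_cancel]
    rw [e1, e3]; ring
  have hf : IntegrableOn (fun t : ℝ => ((Int.fract t : ℝ) : ℂ) * (t : ℂ) ^ (-(s + 1))) (Ioi 1) := by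
    refine Integrable.mono (hI (-(s + 1)) (by simp; linarith)) ?_ ?_
    · refine (AEMeasurable.mul ?_ ?_).aestronglyMeasurable
      · exact (Complex.measurable_ofReal.comp measurable_fract).aemeasurable
      · exact (hI (-(s + 1)) (by simp; linarith)).aestronglyMeasurable.aemeasurable
    · refine Eventually.of_forall fun t => ?_
      rw [norm_mul, Complex.norm_real, Real.norm_eq_abs, Int.abs_fract]
      exact mul_le_of_le_one_left (norm_nonneg _) (Int.fract_lt_one t).le
  rw [integral_sub (hI _ (by simpa using hs)) hf, ← mellin_sawtooth_eq,
    integral_Ioi_cpow_of_lt (by simpa using hs) one_pos] at h3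
  rw [h2, h3] at h1
  have h4 := riemannZeta_eq_inv_sub_mul hs1
  rw [h1] at h4
  have h5 : riemannZeta₁ s = (s - 1) * (s * (-((1 : ℝ) : ℂ) ^ (-s + 1) / (-s + 1) - mellin sawtooth (-s))) := by
    rw [h4]; field_simp
  rw [h5]
  have : -s + 1 ≠ 0 := by rw [neg_add_eq_sub]; exact sub_ne_zero.2 hs1.symm
  simp only [Complex.ofReal_one, Complex.one_cpow]
  field_simp
  ring

lemma isPreconnected_re_gt (a : ℝ) : IsPreconnected {s : ℂ | a < s.re} :=
  (convex_halfSpace_re_gt a).isPreconnected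

lemma isOpen_re_gt (a : ℝ) : IsOpen {s : ℂ | a < s.re} :=
  isOpen_lt continuous_const Complex.continuous_re

lemma riemannZeta₁_eq {s : ℂ} (hs : 0 < s.re) :
    riemannZeta₁ s = s - s * (s - 1) * mellin sawtooth (-s) := by
  have h1 : AnalyticOnNhd ℂ riemannZeta₁ {s : ℂ | 0 < s.re} :=
    (differentiable_riemannZeta₁.differentiableOn).analyticOnNhd (isOpen_re_gt 0)
  have h2 : AnalyticOnNhd ℂ (fun s => s - s * (s - 1) * mellin sawtooth (-s)) {s : ℂ | 0 < s.re} := by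
    refine DifferentiableOn.analyticOnNhd (fun s hs => ?_) (isOpen_re_gt 0)
    have := differentiableAt_mellin_sawtooth hs
    exact DifferentiableAt.differentiableWithinAt (by fun_prop)
  refine h1.eqOn_of_preconnected_of_eventuallyEq h2 (isPreconnected_re_gt 0) (z₀ := 2) (by simp)
    ?_ hs
  filter_upwards [(isOpen_re_gt 1).mem_nhds (show (2 : ℂ) ∈ {s : ℂ | 1 < s.re} by simp)] with z hz
  exact riemannZeta₁_eq_of_one_lt_re hz

lemma norm_riemannZeta₁_le {s : ℂ} (hs : 1 / 2 < s.re) : ‖riemannZeta₁ s‖ ≤ 8 * ‖s‖ ^ 2 := by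
  have hs0 : 0 < s.re := by linarith
  have h1 : 1 / 2 < ‖s‖ := hs.trans_le (Complex.re_le_norm s)
  have h2 : ‖mellin sawtooth (-s)‖ ≤ 2 := (norm_mellin_sawtooth_le hs0).trans (by
    rw [div_le_iff₀ hs0]; linarith)
  have h3 : ‖s - 1‖ ≤ ‖s‖ + 1 := (norm_sub_le _ _).trans (by simp)
  rw [riemannZeta₁_eq hs0]
  calc ‖s - s * (s - 1) * mellin sawtooth (-s)‖
      ≤ ‖s‖ + ‖s‖ * ‖s - 1‖ * ‖mellin sawtooth (-s)‖ := by
        refine (norm_sub_le _ _).trans ?_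
        rw [norm_mul, norm_mul]
    _ ≤ ‖s‖ + ‖s‖ * (‖s‖ + 1) * 2 := by gcongr
    _ ≤ 8 * ‖s‖ ^ 2 := by nlinarith

lemma re_one_add_div_one_sub_pos {w : ℂ} (hw : ‖w‖ < 1) : 0 < ((1 + w) / (1 - w)).re := by
  have h1 : (1 - w) ≠ 0 := by
    intro h
    have : w = 1 := (sub_eq_zero.1 h).symm
    rw [this] at hw; simp at hw
  rw [Complex.div_re, ← add_div]
  refine div_pos ?_ (Complex.normSq_pos.2 h1)
  have h2 : ‖w‖ ^ 2 < 1 := by nlinarith [norm_nonneg w]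
  rw [← Complex.normSq_eq_norm_sq, Complex.normSq_apply] at h2
  simp
  nlinarith

lemma norm_sub_one_div_add_one_lt {z : ℂ} (hz : 0 < z.re) : ‖(z - 1) / (z + 1)‖ < 1 := by
  have h1 : z + 1 ≠ 0 := by
    intro h
    have := congrArg Complex.re h
    simp at this; linarith
  rw [norm_div, div_lt_one (norm_pos_iff.2 h1)]
  refine lt_of_pow_lt_pow_left₀ 2 (norm_nonneg _) ?_
  rw [← Complex.normSq_eq_norm_sq, ← Complex.normSq_eq_norm_sq, Complex.normSq_apply,
    Complex.normSq_apply]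
  simp
  nlinarith

lemma exists_log_on_ball {k : ℂ → ℂ} (hk : DifferentiableOn ℂ k (Metric.ball 0 1))
    (hne : ∀ w ∈ Metric.ball (0 : ℂ) 1, k w ≠ 0) :
    ∃ G : ℂ → ℂ, DifferentiableOn ℂ G (Metric.ball 0 1) ∧
      ∀ w ∈ Metric.ball (0 : ℂ) 1, Complex.exp (G w) = k w := by
  have hb : IsOpen (Metric.ball (0 : ℂ) 1) := Metric.isOpen_ball
  have h0 : (0 : ℂ) ∈ Metric.ball (0 : ℂ) 1 := by simp
  have hq : DifferentiableOn ℂ (fun w => deriv k w / k w) (Metric.ball 0 1) :=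
    (hk.deriv hb).div hk hne
  obtain ⟨G, hG0, hG⟩ := hq.isExactOn_ball.with_val_at 0 (Complex.log (k 0))
  refine ⟨G, fun w hw => (hG w hw).differentiableAt.differentiableWithinAt, fun w hw => ?_⟩
  have hd : ∀ w ∈ Metric.ball (0 : ℂ) 1, HasDerivAt (fun w => k w * Complex.exp (-G w)) 0 w := by
    intro w hw
    have h1 := (hk.differentiableAt (hb.mem_nhds hw)).hasDerivAt
    have h2 := (hG w hw).neg.cexp
    convert! h1.mul h2 using 1
    field_simp [hne w hw]
    ring
  obtain ⟨a, ha⟩ := hb.exists_is_const_of_deriv_eq_zero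
    (convex_ball (0 : ℂ) 1).isPreconnected
    (fun w hw => (hd w hw).differentiableAt.differentiableWithinAt)
    (fun w hw => (hd w hw).deriv)
  have hw1 := ha w hw
  have h01 := ha 0 h0
  simp only [hG0, Complex.exp_neg, Complex.exp_log (hne 0 h0), mul_inv_cancel₀ (hne 0 h0)] at h01
  rw [← h01, Complex.exp_neg] at hw1
  field_simp at hw1
  exact hw1.symm

lemma exists_log_on_re_gt_half {Z : ℂ → ℂ} (hZ : Differentiable ℂ Z)
    (hne : ∀ s : ℂ, 1 / 2 < s.re → Z s ≠ 0) :
    ∃ g : ℂ → ℂ, DifferentiableOn ℂ g {s : ℂ | 1 / 2 < s.re} ∧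
      ∀ s : ℂ, 1 / 2 < s.re → Complex.exp (g s) = Z s := by
  have hφ : ∀ w ∈ Metric.ball (0 : ℂ) 1, 1 / 2 < (1 / 2 + (1 + w) / (1 - w) : ℂ).re := by
    intro w hw
    have := re_one_add_div_one_sub_pos (mem_ball_zero_iff.1 hw)
    rw [Complex.add_re]
    norm_num
    exact this
  obtain ⟨G, hG, hG'⟩ := exists_log_on_ball (k := fun w => Z (1 / 2 + (1 + w) / (1 - w))) (by
      intro w hw
      have h1 : (1 - w) ≠ 0 := by
        intro h
        have : w = 1 := (sub_eq_zero.1 h).symm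
        rw [this] at hw; simp at hw
      have h2 : DifferentiableAt ℂ (fun w : ℂ => 1 / 2 + (1 + w) / (1 - w)) w := by
        fun_prop (disch := assumption)
      exact ((hZ _).comp w h2).differentiableWithinAt) (fun w hw => hne _ (hφ w hw))
  have hψ : ∀ s : ℂ, 1 / 2 < s.re → (s - 1 / 2 - 1) / (s - 1 / 2 + 1) ∈ Metric.ball (0 : ℂ) 1 := by
    intro s hs
    rw [mem_ball_zero_iff]
    apply norm_sub_one_div_add_one_lt
    rw [Complex.sub_re]
    norm_num
    linarith
  have hs1 : ∀ s : ℂ, 1 / 2 < s.re → s - 1 / 2 + 1 ≠ 0 := by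
    intro s hs h
    have := congrArg Complex.re h
    rw [Complex.add_re, Complex.sub_re] at this
    norm_num at this
    linarith
  refine ⟨fun s => G ((s - 1 / 2 - 1) / (s - 1 / 2 + 1)), fun s hs => ?_, fun s hs => ?_⟩
  · have h2 : DifferentiableAt ℂ (fun s : ℂ => (s - 1 / 2 - 1) / (s - 1 / 2 + 1)) s := by
      have := hs1 s hs
      fun_prop (disch := assumption)
    exact ((hG.differentiableAt (Metric.isOpen_ball.mem_nhds (hψ s hs))).comp s
      h2).differentiableWithinAt
  · rw [hG' _ (hψ s hs)]
    congr 1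
    have key : ∀ z : ℂ, z + 1 ≠ 0 → (1 + (z - 1) / (z + 1)) / (1 - (z - 1) / (z + 1)) = z := by
      intro z hz
      rw [show 1 + (z - 1) / (z + 1) = 2 * z / (z + 1) by field_simp; ring,
        show 1 - (z - 1) / (z + 1) = 2 / (z + 1) by field_simp; ring,
        div_div_div_cancel_right₀ hz]
      ring
    rw [key _ (hs1 s hs)]
    ring

/-- Quasi-Riemann hypothesis form: `(s - 1) ζ(s)` has no zeros right of the critical
line. -/
lemma riemannZeta₁_ne_zero_of_RH
    (h : ∀ ρ : ℂ, riemannZeta ρ = 0 → 0 < ρ.re → ρ.re < 1 → ρ.re = 1 / 2)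
    {s : ℂ} (hs : 1 / 2 < s.re) : riemannZeta₁ s ≠ 0 := by
  rcases eq_or_ne s 1 with rfl | hs1
  · simp
  intro h0
  have h1 := riemannZeta_eq_inv_sub_mul hs1
  rw [h0, mul_zero] at h1
  rcases lt_or_ge s.re 1 with h2 | h2
  · have := h s h1 (by linarith) h2
    linarith
  · exact riemannZeta_ne_zero_of_one_le_re h2 h1

lemma norm_riemannZeta_sub_one_le {s : ℂ} (hs : s.re = 2) : ‖riemannZeta s - 1‖ ≤ 2 / 3 := by
  have hs' : 1 < s.re := by linarith
  have h1 := zeta_eq_tsum_one_div_nat_add_one_cpow hs'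
  have hz := (hasSum_nat_add_iff' 1).2 hasSum_zeta_two
  have hz' := (hasSum_nat_add_iff' 2).2 hasSum_zeta_two
  have hn : ∀ n : ℕ, ‖1 / ((n : ℂ) + 1) ^ s‖ = 1 / ((n + 1 : ℕ) : ℝ) ^ 2 := by
    intro n
    rw [norm_div, norm_one]
    have : (n : ℂ) + 1 = ((n + 1 : ℕ) : ℝ) := by push_cast; ring
    rw [this, Complex.norm_cpow_eq_rpow_re_of_pos (by positivity), hs]
    norm_cast
  have hsum : Summable (fun n : ℕ => 1 / ((n : ℂ) + 1) ^ s) := by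
    refine Summable.of_norm ?_
    simp_rw [hn]
    exact hz.summable
  rw [hsum.tsum_eq_zero_add] at h1
  have h2 : riemannZeta s - 1 = ∑' n : ℕ, 1 / (((n + 1 : ℕ) : ℂ) + 1) ^ s := by
    rw [h1]; simp
  rw [h2]
  have h3 : ‖∑' n : ℕ, 1 / (((n + 1 : ℕ) : ℂ) + 1) ^ s‖ ≤ ∑' n : ℕ, 1 / ((n + 2 : ℕ) : ℝ) ^ 2 := by
    refine tsum_of_norm_bounded hz'.summable.hasSum fun n => ?_
    rw [hn]
  refine h3.trans ?_
  rw [hz'.tsum_eq]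
  norm_num [Finset.sum_range_succ]
  nlinarith [Real.pi_lt_d2, Real.pi_pos]

lemma re_two_add_mul_I (t : ℝ) : (2 + t * Complex.I : ℂ).re = 2 := by simp

lemma norm_one_add_mul_I_le (t : ℝ) : ‖(1 + t * Complex.I : ℂ)‖ ≤ 1 + |t| := by
  refine (norm_add_le _ _).trans ?_
  simp

lemma one_le_norm_one_add_mul_I (t : ℝ) : 1 ≤ ‖(1 + t * Complex.I : ℂ)‖ := by
  have := Complex.abs_re_le_norm (1 + t * Complex.I : ℂ)
  simpa using this

lemma log_le_two_mul_sqrt {x : ℝ} (hx : 0 < x) : Real.log x ≤ 2 * √x := by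
  have h1 : Real.log (√x) = Real.log x / 2 := Real.log_sqrt hx.le
  have h2 := Real.log_le_sub_one_of_pos (Real.sqrt_pos.2 hx)
  linarith

lemma hasDerivAt_add_mul_I (σ t : ℝ) :
    HasDerivAt (fun t : ℝ => (σ + t * Complex.I : ℂ)) Complex.I t := by
  have := ((Complex.ofRealCLM.hasDerivAt (x := t)).mul_const Complex.I).const_add (σ : ℂ)
  simpa using this

lemma exists_norm_log_riemannZeta₁_le {g : ℂ → ℂ}
    (hg : DifferentiableOn ℂ g {s : ℂ | 1 / 2 < s.re})
    (hexp : ∀ s : ℂ, 1 / 2 < s.re → Complex.exp (g s) = riemannZeta₁ s) :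
    ∃ C : ℝ, ∀ t : ℝ, ‖g (2 + t * Complex.I)‖ ≤ C * √(1 + |t|) := by
  set L : ℝ → ℂ := fun t => 2 + t * Complex.I with hL
  have hLd : ∀ t, HasDerivAt L Complex.I t := fun t => by
    have h := hasDerivAt_add_mul_I 2 t
    rwa [Complex.ofReal_ofNat] at h
  have hLre : ∀ t, (L t).re = 2 := re_two_add_mul_I
  have hL1 : ∀ t, L t - 1 = 1 + t * Complex.I := fun t => by simp only [hL]; ring
  have hsl1 : ∀ t, L t - 1 ∈ Complex.slitPlane := fun t => by
    rw [hL1]; exact Or.inl (by simp)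
  have hne1 : ∀ t, L t ≠ 1 := fun t h => by
    have := congrArg Complex.re h
    rw [hLre] at this; norm_num at this
  have hz : ∀ t, ‖riemannZeta (L t) - 1‖ ≤ 2 / 3 := fun t => norm_riemannZeta_sub_one_le (hLre t)
  have hsl2 : ∀ t, riemannZeta (L t) ∈ Complex.slitPlane := fun t => by
    have h1 := (Complex.abs_re_le_norm _).trans (hz t)
    rw [Complex.sub_re, Complex.one_re] at h1
    exact Or.inl (by linarith [(abs_le.1 h1).1])
  set F : ℝ → ℂ := fun t => g (L t) - Complex.log (L t - 1) - Complex.log (riemannZeta (L t))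
    with hF
  have hFd : Differentiable ℝ F := by
    intro t
    have h1 : DifferentiableAt ℂ g (L t) :=
      hg.differentiableAt ((isOpen_re_gt _).mem_nhds (by simp only [mem_ofPred_eq, hLre]; norm_num))
    have h2 : DifferentiableAt ℂ (fun s => Complex.log (s - 1)) (L t) :=
      (differentiableAt_id.sub_const 1).clog (hsl1 t)
    have h3 : DifferentiableAt ℂ (fun s => Complex.log (riemannZeta s)) (L t) :=
      (differentiableAt_riemannZeta (hne1 t)).clog (hsl2 t)
    exact (((h1.sub h2).sub h3).hasDerivAt.comp_of_eq t (hLd t) rfl).differentiableAt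
  have hFe : ∀ t, Complex.exp (F t) = 1 := by
    intro t
    have h1 : L t - 1 ≠ 0 := sub_ne_zero.2 (hne1 t)
    have h2 := riemannZeta_ne_zero_of_one_le_re (s := L t) (by rw [hLre]; norm_num)
    rw [hF]
    simp only
    rw [Complex.exp_sub, Complex.exp_sub, hexp _ (by rw [hLre]; norm_num), Complex.exp_log h1,
      Complex.exp_log h2]
    have h3 := riemannZeta_eq_inv_sub_mul (hne1 t)
    rw [div_div, div_eq_one_iff_eq (mul_ne_zero h1 h2), h3]
    field_simp
  have hconst : ∀ t, F t = F 0 := by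
    intro t
    refine is_const_of_deriv_eq_zero hFd (fun t => ?_) t 0
    have h1 := (hFd t).hasDerivAt.cexp
    have h2 : (fun t => Complex.exp (F t)) = fun _ => 1 := funext hFe
    rw [h2] at h1
    have h3 := h1.unique (hasDerivAt_const t (1 : ℂ))
    exact (mul_eq_zero.1 h3).resolve_left (Complex.exp_ne_zero _)
  refine ⟨‖F 0‖ + (2 + Real.pi) + 2, fun t => ?_⟩
  have hs : 1 ≤ √(1 + |t|) := by
    rw [Real.one_le_sqrt]; linarith [abs_nonneg t]
  have hlog1 : ‖Complex.log (L t - 1)‖ ≤ 2 * √(1 + |t|) + Real.pi := by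
    refine (Complex.norm_le_abs_re_add_abs_im _).trans ?_
    rw [Complex.log_re, Complex.log_im, hL1]
    gcongr
    · rw [abs_of_nonneg (Real.log_nonneg (one_le_norm_one_add_mul_I t))]
      refine (Real.log_le_log (lt_of_lt_of_le one_pos (one_le_norm_one_add_mul_I t))
        (norm_one_add_mul_I_le t)).trans ?_
      exact log_le_two_mul_sqrt (by positivity)
    · exact Complex.abs_arg_le_pi _
  have hlog2 : ‖Complex.log (riemannZeta (L t))‖ ≤ 2 := by
    have h1 := Complex.norm_log_one_add_le (z := riemannZeta (L t) - 1) ((hz t).trans_lt (by norm_num))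
    rw [add_sub_cancel] at h1
    have hz' := hz t
    set r := ‖riemannZeta (L t) - 1‖
    have hr : 0 ≤ r := norm_nonneg _
    have h2 : (1 - r)⁻¹ ≤ 3 := by
      rw [inv_le_comm₀ (by linarith) (by norm_num)]; linarith
    have h2' : 0 ≤ (1 - r)⁻¹ := inv_nonneg.2 (by linarith)
    have h3 : r ^ 2 * (1 - r)⁻¹ ≤ (2 / 3) ^ 2 * 3 := by gcongr
    linarith
  have h4 : g (L t) = F 0 + Complex.log (L t - 1) + Complex.log (riemannZeta (L t)) := by
    rw [← hconst t]; simp only [hF]; ring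
  have h5 : ‖g (L t)‖ ≤ ‖F 0‖ + (2 * √(1 + |t|) + Real.pi) + 2 := by
    rw [h4]
    refine (norm_add_le _ _).trans (add_le_add ((norm_add_le _ _).trans (add_le_add le_rfl hlog1)) hlog2)
  refine h5.trans ?_
  nlinarith [norm_nonneg (F 0), Real.pi_pos]

lemma re_log_riemannZeta₁_le {g : ℂ → ℂ}
    (hexp : ∀ s : ℂ, 1 / 2 < s.re → Complex.exp (g s) = riemannZeta₁ s) {s : ℂ}
    (hs : 1 / 2 < s.re) : (g s).re ≤ Real.log 8 + 2 * Real.log ‖s‖ := by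
  have h1 := norm_riemannZeta₁_le hs
  have h2 : 0 < ‖s‖ := lt_of_lt_of_le (by linarith) (Complex.re_le_norm s)
  rw [← hexp s hs, Complex.norm_exp] at h1
  have h3 := Real.log_le_log (Real.exp_pos _) h1
  rw [Real.log_exp, Real.log_mul (by norm_num) (by positivity), Real.log_pow] at h3
  exact_mod_cast h3

lemma re_ofReal_add_mul_I (σ t : ℝ) : (σ + t * Complex.I : ℂ).re = σ := by simp

lemma im_ofReal_add_mul_I (σ t : ℝ) : (σ + t * Complex.I : ℂ).im = t := by simp

lemma one_le_sqrt_one_add_abs (t : ℝ) : 1 ≤ √(1 + |t|) := by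
  rw [Real.one_le_sqrt]; linarith [abs_nonneg t]

lemma norm_le_of_re_le {s : ℂ} {c : ℝ} (h0 : 0 ≤ s.re) (h : s.re ≤ c) : ‖s‖ ≤ c + |s.im| := by
  refine (Complex.norm_le_abs_re_add_abs_im s).trans ?_
  rw [abs_of_nonneg h0]; gcongr

lemma log_add_abs_le (t : ℝ) : Real.log (4 + |t|) ≤ 4 * √(1 + |t|) := by
  have h0 := abs_nonneg t
  refine (log_le_two_mul_sqrt (by positivity)).trans ?_
  have h1 : √(4 + |t|) ≤ √(2 ^ 2 * (1 + |t|)) := Real.sqrt_le_sqrt (by linarith)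
  rw [Real.sqrt_mul (by positivity), Real.sqrt_sq (by norm_num)] at h1
  linarith

lemma exists_norm_le_sqrt_of_re_le {g : ℂ → ℂ} {C₀ C₁ : ℝ}
    (hg : DifferentiableOn ℂ g {s : ℂ | 1 / 2 < s.re})
    (hre : ∀ s : ℂ, 1 / 2 < s.re → (g s).re ≤ C₀ + 2 * Real.log ‖s‖)
    (hline : ∀ t : ℝ, ‖g (2 + t * Complex.I)‖ ≤ C₁ * √(1 + |t|)) {δ : ℝ} (hδ : 0 < δ) :
    ∃ C : ℝ, 0 ≤ C ∧ ∀ s : ℂ, 1 / 2 + δ ≤ s.re → s.re ≤ 2 → ‖g s‖ ≤ C * √(1 + |s.im|) := by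
  have hC₁ : 0 ≤ C₁ := by simpa using (norm_nonneg _).trans (hline 0)
  refine ⟨3 * (|C₀| + 9) / δ + C₁ * (3 / δ), by positivity, fun s hs1 hs2 => ?_⟩
  set t := s.im
  set c : ℂ := 2 + t * Complex.I with hc
  have hr1 := one_le_sqrt_one_add_abs t
  set M : ℝ := (|C₀| + 9) * √(1 + |t|) with hM
  have hball : ∀ z ∈ Metric.ball (0 : ℂ) (3 / 2), 1 / 2 < (c + z).re ∧ ‖c + z‖ ≤ 4 + |t| := by
    intro z hz
    rw [mem_ball_zero_iff] at hz
    have h1 := (Complex.abs_re_le_norm z).trans_lt hz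
    constructor
    · rw [Complex.add_re, hc, re_two_add_mul_I]; linarith [(abs_lt.1 h1).1]
    · refine (norm_add_le _ _).trans ?_
      have : ‖c‖ ≤ 2 + |t| := (norm_add_le _ _).trans (by simp)
      linarith
  have hd : DifferentiableOn ℂ (fun z => g (c + z)) (Metric.ball 0 (3 / 2)) := by
    refine hg.comp (by fun_prop) fun z hz => (hball z hz).1
  have hmap : MapsTo (fun z => g (c + z)) (Metric.ball 0 (3 / 2)) {z | z.re ≤ M} := by
    intro z hz
    obtain ⟨h1, h2⟩ := hball z hz
    have h3 := hre _ h1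
    have h4 : Real.log ‖c + z‖ ≤ 4 * √(1 + |t|) :=
      (Real.log_le_log (lt_of_lt_of_le (by linarith) (Complex.re_le_norm _)) h2).trans
        (log_add_abs_le t)
    show (g (c + z)).re ≤ M
    have h5 : C₀ ≤ |C₀| * √(1 + |t|) := (le_abs_self _).trans
      (le_mul_of_one_le_right (abs_nonneg _) hr1)
    rw [hM]; nlinarith
  have hw : s - c = ((s.re - 2 : ℝ) : ℂ) := by
    apply Complex.ext <;> simp [hc, t]
  have hnorm : ‖s - c‖ = 2 - s.re := by
    rw [hw, Complex.norm_real, Real.norm_eq_abs, abs_of_nonpos (by linarith)]; ring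
  have hmem : s - c ∈ Metric.ball (0 : ℂ) (3 / 2) := by
    rw [mem_ball_zero_iff, hnorm]; linarith
  have hMpos : 0 < M := by positivity
  have hB := Complex.borelCaratheodory hMpos hd hmap (by norm_num) hmem
  simp only [add_sub_cancel, add_zero] at hB
  rw [hnorm] at hB
  have h6 : 0 < 3 / 2 - (2 - s.re) := by linarith
  have h7 : 1 / (3 / 2 - (2 - s.re)) ≤ 1 / δ := one_div_le_one_div_of_le hδ (by linarith)
  have hgc : ‖g c‖ ≤ C₁ * √(1 + |t|) := hline t
  calc ‖g s‖ ≤ 2 * M * (2 - s.re) / (3 / 2 - (2 - s.re))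
        + ‖g c‖ * (3 / 2 + (2 - s.re)) / (3 / 2 - (2 - s.re)) := hB
    _ = (2 * M * (2 - s.re) + ‖g c‖ * (3 / 2 + (2 - s.re))) * (1 / (3 / 2 - (2 - s.re))) := by ring
    _ ≤ (2 * M * (3 / 2) + C₁ * √(1 + |t|) * 3) * (1 / δ) := by
        have : 0 ≤ 2 - s.re := by linarith
        gcongr <;> linarith
    _ = _ := by rw [hM]; ring

lemma integrable_one_add_abs_rpow {r : ℝ} (hr : 1 < r) :
    Integrable (fun t : ℝ => (1 + |t|) ^ (-r)) := by
  have := integrable_one_add_norm (E := ℝ) (μ := volume) (r := r) (by simpa using hr)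
  simpa using this

lemma continuous_comp_vertical {G : ℂ → ℂ} {S : Set ℂ} (hG : ContinuousOn G S) {a : ℝ}
    (h : ∀ t : ℝ, (a + t * Complex.I : ℂ) ∈ S) : Continuous fun t : ℝ => G (a + t * Complex.I) := by
  rw [← continuousOn_univ]
  exact hG.comp (by fun_prop) fun t _ => h t

lemma integrable_vertical {G : ℂ → ℂ} {S : Set ℂ} (hG : ContinuousOn G S) {a C r : ℝ} (hr : 1 < r)
    (h : ∀ t : ℝ, (a + t * Complex.I : ℂ) ∈ S)
    (hb : ∀ t : ℝ, ‖G (a + t * Complex.I)‖ ≤ C * (1 + |t|) ^ (-r)) :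
    Integrable fun t : ℝ => G (a + t * Complex.I) :=
  ((integrable_one_add_abs_rpow hr).const_mul C).mono'
    (continuous_comp_vertical hG h).aestronglyMeasurable (Eventually.of_forall hb)

/-- Shifting a vertical line of integration. -/
lemma integral_vertical_eq {G : ℂ → ℂ} {a b C r : ℝ} (hab : a ≤ b) (hr : 1 < r)
    (hG : DifferentiableOn ℂ G {s : ℂ | a ≤ s.re ∧ s.re ≤ b})
    (hb : ∀ s : ℂ, a ≤ s.re → s.re ≤ b → ‖G s‖ ≤ C * (1 + |s.im|) ^ (-r)) :
    ∫ t : ℝ, G (a + t * Complex.I) = ∫ t : ℝ, G (b + t * Complex.I) := by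
  have hline : ∀ c : ℝ, a ≤ c → c ≤ b → ∀ t : ℝ,
      ‖G (c + t * Complex.I)‖ ≤ C * (1 + |t|) ^ (-r) := by
    intro c h1 h2 t
    have := hb (c + t * Complex.I) (by simpa) (by simpa)
    simpa using this
  have hint : ∀ c : ℝ, a ≤ c → c ≤ b → Integrable fun t : ℝ => G (c + t * Complex.I) := by
    intro c h1 h2
    exact integrable_vertical hG.continuousOn hr (fun t => by simp [h1, h2]) (hline c h1 h2)
  have hlim : ∀ c : ℝ, a ≤ c → c ≤ b → Tendsto (fun T : ℝ => ∫ t in (-T)..T, G (c + t * Complex.I))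
      atTop (𝓝 (∫ t : ℝ, G (c + t * Complex.I))) := fun c h1 h2 =>
    intervalIntegral_tendsto_integral (hint c h1 h2) tendsto_neg_atTop_atBot tendsto_id
  have hrect : ∀ T : ℝ, 0 ≤ T →
      ‖(∫ t in (-T)..T, G (b + t * Complex.I)) - ∫ t in (-T)..T, G (a + t * Complex.I)‖ ≤
        2 * (C * (1 + T) ^ (-r) * |b - a|) := by
    intro T hT
    have h0 := Complex.integral_boundary_rect_eq_zero_of_differentiableOn G (a + (-T : ℝ) * Complex.I)
      (b + (T : ℝ) * Complex.I) (hG.mono (by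
        intro s hs
        rw [Complex.mem_reProdIm] at hs
        simp only [re_ofReal_add_mul_I, uIcc_of_le hab] at hs
        exact hs.1))
    simp only [re_ofReal_add_mul_I, im_ofReal_add_mul_I] at h0
    have hh : ∀ y : ℝ, |y| = T → ‖∫ x in a..b, G (x + y * Complex.I)‖ ≤ C * (1 + T) ^ (-r) * |b - a| := by
      intro y hy
      refine intervalIntegral.norm_integral_le_of_norm_le_const fun x hx => ?_
      rw [uIoc_of_le hab] at hx
      have := hline x hx.1.le hx.2 y
      rwa [hy] at this
    have h1 := hh (-T) (by rw [abs_neg, abs_of_nonneg hT])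
    have h2 := hh T (abs_of_nonneg hT)
    set X := ∫ x in a..b, G (x + (-T : ℝ) * Complex.I)
    set Y := ∫ x in a..b, G (x + T * Complex.I)
    set U := ∫ t in (-T)..T, G (b + t * Complex.I)
    set V := ∫ t in (-T)..T, G (a + t * Complex.I)
    have h3 : Complex.I * (U - V) = Y - X := by
      simp only [smul_eq_mul] at h0
      linear_combination h0
    have h4 : ‖U - V‖ = ‖Y - X‖ := by
      rw [← h3, norm_mul, Complex.norm_I, one_mul]
    rw [h4]
    refine (norm_sub_le _ _).trans ?_
    linarith
  have hz : Tendsto (fun T : ℝ => 2 * (C * (1 + T) ^ (-r) * |b - a|)) atTop (𝓝 0) := by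
    have h1 : Tendsto (fun T : ℝ => (1 + T) ^ (-r)) atTop (𝓝 0) :=
      (tendsto_rpow_neg_atTop (by linarith)).comp (tendsto_atTop_add_const_left _ _ tendsto_id)
    have := ((h1.const_mul C).mul_const (|b - a|)).const_mul 2
    simpa using this
  have h5 : Tendsto (fun T : ℝ => (∫ t in (-T)..T, G (b + t * Complex.I)) -
      ∫ t in (-T)..T, G (a + t * Complex.I)) atTop (𝓝 0) :=
    squeeze_zero_norm' ((eventually_ge_atTop 0).mono hrect) hz
  have h6 := tendsto_nhds_unique h5 ((hlim b hab le_rfl).sub (hlim a le_rfl hab))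
  exact (sub_eq_zero.1 h6.symm).symm

/-- The kernel `1 / (s (s + 1))`. -/
noncomputable def perronKernel (s : ℂ) : ℂ := 1 / (s * (s + 1))

/-- The derivative of `perronKernel`. -/
noncomputable def perronKernelDeriv (s : ℂ) : ℂ := -(2 * s + 1) / (s * (s + 1)) ^ 2

/-- The derivative of `s ↦ exp (u s) / (s (s + 1))`. -/
noncomputable def perronWeight (u : ℝ) (s : ℂ) : ℂ :=
  Complex.exp (u * s) * (u * perronKernel s + perronKernelDeriv s)

lemma ne_zero_of_re_pos {s : ℂ} (hs : 0 < s.re) : s ≠ 0 := by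
  rintro rfl; simp at hs

lemma add_one_ne_zero_of_re_pos {s : ℂ} (hs : 0 < s.re) : s + 1 ≠ 0 :=
  ne_zero_of_re_pos (by simp; linarith)

lemma hasDerivAt_perronKernel {s : ℂ} (hs : 0 < s.re) :
    HasDerivAt perronKernel (perronKernelDeriv s) s := by
  have h0 := ne_zero_of_re_pos hs
  have h1 := add_one_ne_zero_of_re_pos hs
  have h2 := ((hasDerivAt_id s).mul ((hasDerivAt_id s).add_const 1)).inv (mul_ne_zero h0 h1)
  have h3 : perronKernel = fun s => (s * (s + 1))⁻¹ := by
    ext; simp only [perronKernel, one_div]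
  rw [h3]
  convert! h2 using 1
  simp only [perronKernelDeriv, Pi.mul_apply, id]
  ring

lemma hasDerivAt_exp_mul_perronKernel (u : ℝ) {s : ℂ} (hs : 0 < s.re) :
    HasDerivAt (fun s => Complex.exp (u * s) * perronKernel s) (perronWeight u s) s := by
  have h1 := (((hasDerivAt_id s).const_mul (u : ℂ)).cexp).mul (hasDerivAt_perronKernel hs)
  convert! h1 using 1
  simp only [perronWeight, id]
  ring

lemma differentiableAt_perronWeight (u : ℝ) {s : ℂ} (hs : 0 < s.re) :
    DifferentiableAt ℂ (perronWeight u) s := by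
  have h0 := ne_zero_of_re_pos hs
  have h1 := add_one_ne_zero_of_re_pos hs
  unfold perronWeight perronKernel perronKernelDeriv
  have h2 : s * (s + 1) ≠ 0 := mul_ne_zero h0 h1
  have h3 : (s * (s + 1)) ^ 2 ≠ 0 := pow_ne_zero _ h2
  fun_prop (disch := assumption)

lemma one_add_abs_im_le_norm {s : ℂ} (hs : 1 / 4 ≤ s.re) : 1 + |s.im| ≤ 5 * ‖s‖ := by
  linarith [Complex.re_le_norm s, Complex.abs_im_le_norm s]

lemma norm_perronKernel_le {s : ℂ} (hs : 1 / 4 ≤ s.re) :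
    ‖perronKernel s‖ ≤ 25 * (1 + |s.im|) ^ (-2 : ℝ) := by
  have h1 := one_add_abs_im_le_norm hs
  have h2 := one_add_abs_im_le_norm (s := s + 1) (by simp; linarith)
  simp only [Complex.add_im, Complex.one_im, add_zero] at h2
  have h3 := abs_nonneg s.im
  rw [perronKernel, norm_div, norm_mul, norm_one, Real.rpow_neg (by positivity)]
  norm_num
  rw [← mul_inv, inv_le_iff_one_le_mul₀ (by nlinarith)]
  rw [mul_comm 25, mul_assoc, inv_mul_eq_div, le_div_iff₀ (by positivity)]
  nlinarith

lemma norm_perronKernelDeriv_le {s : ℂ} (hs : 1 / 4 ≤ s.re) :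
    ‖perronKernelDeriv s‖ ≤ 125 * (1 + |s.im|) ^ (-2 : ℝ) := by
  have hs' : 0 < s.re := by linarith
  have h0 := ne_zero_of_re_pos hs'
  have h1 := add_one_ne_zero_of_re_pos hs'
  have e : perronKernelDeriv s = -(1 / s + 1 / (s + 1)) * perronKernel s := by
    rw [perronKernelDeriv, perronKernel]; field_simp; ring
  have h2 : ‖1 / s‖ ≤ 4 := by
    rw [norm_div, norm_one, div_le_iff₀ (norm_pos_iff.2 h0)]
    linarith [Complex.re_le_norm s]
  have h3 : ‖1 / (s + 1)‖ ≤ 1 := by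
    rw [norm_div, norm_one, div_le_one (norm_pos_iff.2 h1)]
    have := Complex.re_le_norm (s + 1)
    simp at this; linarith
  rw [e, norm_mul, norm_neg]
  calc ‖1 / s + 1 / (s + 1)‖ * ‖perronKernel s‖
      ≤ (4 + 1) * (25 * (1 + |s.im|) ^ (-2 : ℝ)) := by
        gcongr
        · exact (norm_add_le _ _).trans (add_le_add h2 h3)
        · exact norm_perronKernel_le hs
    _ = _ := by ring

lemma norm_perronWeight_le {u : ℝ} (hu : 0 ≤ u) {s : ℂ} (hs : 1 / 4 ≤ s.re) :
    ‖perronWeight u s‖ ≤ 125 * (Real.exp (u * s.re) * (u + 1)) * (1 + |s.im|) ^ (-2 : ℝ) := by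
  have h1 := norm_perronKernel_le hs
  have h2 := norm_perronKernelDeriv_le hs
  have h3 : 0 ≤ (1 + |s.im|) ^ (-2 : ℝ) := by positivity
  set P := (1 + |s.im|) ^ (-2 : ℝ)
  rw [perronWeight, norm_mul, Complex.norm_exp]
  have e : (u * s : ℂ).re = u * s.re := by simp
  rw [e]
  have h4 : ‖(u : ℂ) * perronKernel s + perronKernelDeriv s‖ ≤ 125 * (u + 1) * P := by
    refine (norm_add_le _ _).trans ?_
    rw [norm_mul, Complex.norm_real, Real.norm_of_nonneg hu]
    nlinarith [mul_le_mul_of_nonneg_left h1 hu, mul_nonneg hu h3]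
  calc _ ≤ Real.exp (u * s.re) * (125 * (u + 1) * P) := by gcongr
    _ = _ := by ring

lemma sqrt_mul_rpow_neg_two {x : ℝ} (hx : 0 < x) : √x * x ^ (-2 : ℝ) = x ^ (-(3 / 2) : ℝ) := by
  rw [Real.sqrt_eq_rpow, ← Real.rpow_add hx]; norm_num

lemma norm_mul_perronWeight_le {u : ℝ} (hu : 0 ≤ u) {s : ℂ} (hs : 1 / 4 ≤ s.re) {y : ℂ} {C : ℝ}
    (hC : 0 ≤ C) (hy : ‖y‖ ≤ C * √(1 + |s.im|)) :
    ‖y * perronWeight u s‖ ≤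
      C * (125 * (Real.exp (u * s.re) * (u + 1))) * (1 + |s.im|) ^ (-(3 / 2) : ℝ) := by
  rw [← sqrt_mul_rpow_neg_two (by positivity), norm_mul]
  calc _ ≤ (C * √(1 + |s.im|)) *
        (125 * (Real.exp (u * s.re) * (u + 1)) * (1 + |s.im|) ^ (-2 : ℝ)) := by
        gcongr
        exact norm_perronWeight_le hu hs
    _ = _ := by ring

/-- Reflecting the weight in the line `Re s = σ` is complex conjugation on that line. -/
lemma conj_perronWeight (u : ℝ) (s : ℂ) :
    (starRingEnd ℂ) (perronWeight u s) = perronWeight u ((starRingEnd ℂ) s) := by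
  simp only [perronWeight, perronKernel, perronKernelDeriv, map_mul, map_add, map_div₀, map_neg,
    map_one, map_pow, Complex.conj_ofReal, ← Complex.exp_conj, Complex.conj_ofNat]

lemma sqrt_div_sq_add_sq_le {T : ℝ} (hT : 1 ≤ T) (t : ℝ) :
    √(1 + |t|) * (1 / (T ^ 2 + t ^ 2)) ≤ 4 * T ^ (-(1 / 4) : ℝ) * (1 + |t|) ^ (-(5 / 4) : ℝ) := by
  have hx : 0 < 1 + |t| := by positivity
  have hT0 : 0 < T := by linarith
  set M := max T |t| with hM
  have hM0 : 0 < M := lt_max_of_lt_left hT0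
  have h1 : M ^ 2 ≤ T ^ 2 + t ^ 2 := by
    rcases max_choice T |t| with h | h <;> rw [hM, h]
    · nlinarith [sq_nonneg t]
    · rw [sq_abs]; nlinarith
  have h2 : (1 + |t|) / 2 ≤ M := by
    have := le_max_left T |t|
    have := le_max_right T |t|
    linarith
  have h3 : T ^ (1 / 4 : ℝ) * ((1 + |t|) / 2) ^ (7 / 4 : ℝ) ≤ M ^ 2 := by
    calc _ ≤ M ^ (1 / 4 : ℝ) * M ^ (7 / 4 : ℝ) := by
          gcongr
          exact le_max_left _ _
      _ = M ^ 2 := by rw [← Real.rpow_add hM0, ← Real.rpow_natCast]; norm_num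
  have h4 : (2 : ℝ) ^ (7 / 4 : ℝ) ≤ 4 := by
    calc (2 : ℝ) ^ (7 / 4 : ℝ) ≤ 2 ^ (2 : ℝ) := Real.rpow_le_rpow_of_exponent_le (by norm_num) (by norm_num)
      _ = 4 := by norm_num
  rw [Real.div_rpow hx.le (by norm_num)] at h3
  have h5 : T ^ (1 / 4 : ℝ) * (1 + |t|) ^ (7 / 4 : ℝ) / 4 ≤ T ^ 2 + t ^ 2 := by
    refine le_trans ?_ (h3.trans h1)
    rw [← mul_div_assoc]
    gcongr
  have h6 : 1 / (T ^ 2 + t ^ 2) ≤ 1 / (T ^ (1 / 4 : ℝ) * (1 + |t|) ^ (7 / 4 : ℝ) / 4) :=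
    one_div_le_one_div_of_le (by positivity) h5
  calc _ ≤ √(1 + |t|) * (1 / (T ^ (1 / 4 : ℝ) * (1 + |t|) ^ (7 / 4 : ℝ) / 4)) := by gcongr
    _ = 4 * T ^ (-(1 / 4) : ℝ) * (√(1 + |t|) * (1 + |t|) ^ (-(7 / 4) : ℝ)) := by
        rw [Real.rpow_neg hT0.le, Real.rpow_neg hx.le]; field_simp
    _ = _ := by
        rw [Real.sqrt_eq_rpow, ← Real.rpow_add hx]; norm_num

lemma sq_sub_sq_vertical_re {T σ : ℝ} (s : ℂ) :
    ((T : ℂ) ^ 2 - (s - σ) ^ 2).re = T ^ 2 - (s.re - σ) ^ 2 + s.im ^ 2 := by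
  simp [pow_two]
  ring

lemma norm_resolvent_le {T σ : ℝ} (hT : 3 ≤ T) {s : ℂ} (h1 : σ ≤ s.re) (h2 : s.re ≤ σ + 3 / 2) :
    (T : ℂ) ^ 2 - (s - σ) ^ 2 ≠ 0 ∧
    ‖1 / ((T : ℂ) ^ 2 - (s - σ) ^ 2)‖ ≤ 4 / 3 * (1 / (T ^ 2 + s.im ^ 2)) := by
  have h3 : 3 / 4 * (T ^ 2 + s.im ^ 2) ≤ ((T : ℂ) ^ 2 - (s - σ) ^ 2).re := by
    rw [sq_sub_sq_vertical_re]
    nlinarith [sq_nonneg s.im]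
  have h4 : 0 < 3 / 4 * (T ^ 2 + s.im ^ 2) := by nlinarith [sq_nonneg s.im]
  refine ⟨ne_zero_of_re_pos (h4.trans_le h3), ?_⟩
  rw [norm_div, norm_one]
  refine (one_div_le_one_div_of_le h4 (h3.trans (Complex.re_le_norm _))).trans (le_of_eq ?_)
  field_simp

lemma abs_log_norm_le {s : ℂ} (h1 : 1 / 2 ≤ s.re) (h2 : s.re ≤ 2) :
    |Real.log ‖s‖| ≤ 4 * √(1 + |s.im|) := by
  have h3 : 1 / 2 ≤ ‖s‖ := h1.trans (Complex.re_le_norm s)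
  have h4 : ‖s‖ ≤ 4 + |s.im| := (norm_le_of_re_le (by linarith) h2).trans (by linarith)
  rw [abs_le]
  constructor
  · have h5 := Real.one_sub_inv_le_log_of_pos (x := ‖s‖) (by linarith)
    have h6 : ‖s‖⁻¹ ≤ 2 := by rw [inv_le_comm₀ (by linarith) (by norm_num)]; linarith
    linarith [one_le_sqrt_one_add_abs s.im]
  · exact (Real.log_le_log (by linarith) h4).trans (log_add_abs_le _)

lemma norm_log_le {s : ℂ} (h1 : 1 / 2 ≤ s.re) (h2 : s.re ≤ 2) :
    ‖Complex.log s‖ ≤ 8 * √(1 + |s.im|) := by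
  refine (Complex.norm_le_abs_re_add_abs_im _).trans ?_
  rw [Complex.log_re, Complex.log_im]
  have := abs_log_norm_le h1 h2
  have := Complex.abs_arg_le_pi s
  have := Real.pi_le_four
  have := one_le_sqrt_one_add_abs s.im
  linarith

/-- Poisson-type bound for the real part of a logarithm of at most logarithmic growth, uniform up
to the boundary. -/
lemma exists_tail_bound {g : ℂ → ℂ} {C₀ C₁ : ℝ}
    (hg : DifferentiableOn ℂ g {s : ℂ | 1 / 2 < s.re})
    (hre : ∀ s : ℂ, 1 / 2 < s.re → (g s).re ≤ C₀ + 2 * Real.log ‖s‖)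
    (hline : ∀ t : ℝ, ‖g (2 + t * Complex.I)‖ ≤ C₁ * √(1 + |t|)) :
    ∃ C : ℝ, 0 ≤ C ∧ ∀ σ T : ℝ, 1 / 2 < σ → σ ≤ 1 → 3 ≤ T →
      Integrable (fun t : ℝ => |(g (σ + t * Complex.I)).re| * (1 / (T ^ 2 + t ^ 2))) ∧
      ∫ t : ℝ, |(g (σ + t * Complex.I)).re| * (1 / (T ^ 2 + t ^ 2)) ≤ C * T ^ (-(1 / 4) : ℝ) := by
  have hC₁ : 0 ≤ C₁ := by simpa using (norm_nonneg _).trans (hline 0)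
  set A := ∫ t : ℝ, (1 + |t|) ^ (-(5 / 4) : ℝ) with hA
  have hA0 : 0 ≤ A := integral_nonneg fun t => by positivity
  set C₂ : ℝ := |C₀| + 16 + C₁ with hC₂
  have hC₂0 : 0 ≤ C₂ := by positivity
  set h : ℂ → ℂ := fun s => C₀ + 2 * Complex.log s - g s with hh
  have hhd : DifferentiableOn ℂ h {s : ℂ | 1 / 2 < s.re} := by
    refine DifferentiableOn.sub ?_ hg
    intro s hs
    have hs' : s ∈ Complex.slitPlane := Or.inl (by
      have : 1 / 2 < s.re := hs
      linarith)
    exact (((Complex.differentiableAt_log hs').const_mul 2).const_add _).differentiableWithinAt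
  have hh0 : ∀ s : ℂ, 1 / 2 < s.re → 0 ≤ (h s).re := by
    intro s hs
    have := hre s hs
    simp only [hh, Complex.sub_re, Complex.add_re, Complex.ofReal_re, Complex.mul_re,
      Complex.log_re, Complex.re_ofNat, Complex.im_ofNat, zero_mul, sub_zero]
    linarith
  have hgn : ∀ s : ℂ, 1 / 2 < s.re → s.re ≤ 2 → ∀ B, ‖g s‖ ≤ B * √(1 + |s.im|) →
      ‖h s‖ ≤ (|C₀| + 16 + B) * √(1 + |s.im|) := by
    intro s h1 h2 B hB
    have h3 : ‖(C₀ : ℂ)‖ ≤ |C₀| * √(1 + |s.im|) := by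
      rw [Complex.norm_real]
      exact le_mul_of_one_le_right (abs_nonneg _) (one_le_sqrt_one_add_abs _)
    have h4 : ‖2 * Complex.log s‖ ≤ 16 * √(1 + |s.im|) := by
      rw [norm_mul, Complex.norm_ofNat]
      linarith [norm_log_le h1.le h2]
    refine (norm_sub_le _ _).trans ((add_le_add (norm_add_le _ _) le_rfl).trans ?_)
    linarith
  have hgh : ∀ s : ℂ, 1 / 2 < s.re → s.re ≤ 2 →
      |(g s).re| ≤ (h s).re + (|C₀| + 8) * √(1 + |s.im|) := by
    intro s h1 h2
    have e : (g s).re = C₀ + 2 * Real.log ‖s‖ - (h s).re := by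
      simp only [hh, Complex.sub_re, Complex.add_re, Complex.ofReal_re, Complex.mul_re,
        Complex.log_re, Complex.re_ofNat, Complex.im_ofNat, zero_mul, sub_zero]
      ring
    have h3 := abs_le.1 (abs_log_norm_le h1.le h2)
    have h4 := hh0 s h1
    have h5 : |C₀| ≤ |C₀| * √(1 + |s.im|) :=
      le_mul_of_one_le_right (abs_nonneg _) (one_le_sqrt_one_add_abs _)
    have h6 := abs_le.1 (le_refl |C₀|)
    rw [e, abs_le]
    constructor <;> linarith
  have hpow : Integrable (fun t : ℝ => (1 + |t|) ^ (-(5 / 4) : ℝ)) :=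
    integrable_one_add_abs_rpow (by norm_num)
  refine ⟨C₂ * (16 / 3) * A + (|C₀| + 8) * (4 * A), by positivity, fun σ T hσ hσ1 hT => ?_⟩
  have hT0 : 0 < T := by linarith
  obtain ⟨B, hB0, hB⟩ := exists_norm_le_sqrt_of_re_le hg hre hline (δ := σ - 1 / 2) (by linarith)
  have hsub : {s : ℂ | σ ≤ s.re ∧ s.re ≤ 2} ⊆ {s : ℂ | 1 / 2 < s.re} := fun s hs =>
    hσ.trans_le hs.1
  set G : ℂ → ℂ := fun s => h s * (1 / ((T : ℂ) ^ 2 - (s - σ) ^ 2)) with hG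
  have hGd : DifferentiableOn ℂ G {s : ℂ | σ ≤ s.re ∧ s.re ≤ 2} := by
    refine (hhd.mono hsub).mul fun s hs => ?_
    have hne := (norm_resolvent_le hT hs.1 (by linarith [hs.2])).1
    have : DifferentiableAt ℂ (fun s : ℂ => 1 / ((T : ℂ) ^ 2 - (s - σ) ^ 2)) s := by
      fun_prop (disch := assumption)
    exact this.differentiableWithinAt
  have hGb : ∀ s : ℂ, σ ≤ s.re → s.re ≤ 2 → ∀ D : ℝ, 0 ≤ D → ‖h s‖ ≤ D * √(1 + |s.im|) →
      ‖G s‖ ≤ D * (16 / 3) * T ^ (-(1 / 4) : ℝ) * (1 + |s.im|) ^ (-(5 / 4) : ℝ) := by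
    intro s h1 h2 D hD hs
    have h3 := (norm_resolvent_le hT h1 (by linarith)).2
    have h4 := sqrt_div_sq_add_sq_le (T := T) (by linarith) s.im
    rw [hG]
    simp only [norm_mul]
    calc _ ≤ (D * √(1 + |s.im|)) * (4 / 3 * (1 / (T ^ 2 + s.im ^ 2))) := by gcongr
      _ = D * (4 / 3) * (√(1 + |s.im|) * (1 / (T ^ 2 + s.im ^ 2))) := by ring
      _ ≤ D * (4 / 3) * (4 * T ^ (-(1 / 4) : ℝ) * (1 + |s.im|) ^ (-(5 / 4) : ℝ)) := by gcongr
      _ = _ := by ring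
  have hGb' : ∀ s : ℂ, σ ≤ s.re → s.re ≤ 2 →
      ‖G s‖ ≤ (|C₀| + 16 + B) * (16 / 3) * T ^ (-(1 / 4) : ℝ) * (1 + |s.im|) ^ (-(5 / 4) : ℝ) :=
    fun s h1 h2 => hGb s h1 h2 _ (by positivity)
      (hgn s (hσ.trans_le h1) h2 B (hB s (by linarith) h2))
  have hshift := integral_vertical_eq (a := σ) (b := 2) (r := 5 / 4) (by linarith) (by norm_num)
    hGd hGb'
  have hGσ : Integrable fun t : ℝ => G (σ + t * Complex.I) := by
    refine integrable_vertical (r := 5 / 4)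
      (C := (|C₀| + 16 + B) * (16 / 3) * T ^ (-(1 / 4) : ℝ)) hGd.continuousOn (by norm_num) (fun t => ?_) (fun t => ?_)
    · simp; linarith
    · have := hGb' (σ + t * Complex.I) (by simp) (by simp; linarith)
      simpa only [im_ofReal_add_mul_I] using this
  have hGre : ∀ t : ℝ, (G (σ + t * Complex.I)).re =
      (h (σ + t * Complex.I)).re * (1 / (T ^ 2 + t ^ 2)) := by
    intro t
    have e : (1 / ((T : ℂ) ^ 2 - ((σ + t * Complex.I : ℂ) - σ) ^ 2)) =
        ((1 / (T ^ 2 + t ^ 2) : ℝ) : ℂ) := by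
      push_cast
      rw [add_sub_cancel_left, mul_pow, Complex.I_sq]
      ring
    rw [hG]
    simp only
    rw [e, Complex.re_mul_ofReal]
  have hint : Integrable fun t : ℝ => (h (σ + t * Complex.I)).re * (1 / (T ^ 2 + t ^ 2)) := by
    have := hGσ.re
    refine this.congr (Eventually.of_forall fun t => ?_)
    exact hGre t
  have hval : ∫ t : ℝ, (h (σ + t * Complex.I)).re * (1 / (T ^ 2 + t ^ 2)) ≤
      C₂ * (16 / 3) * A * T ^ (-(1 / 4) : ℝ) := by
    calc ∫ t : ℝ, (h (σ + t * Complex.I)).re * (1 / (T ^ 2 + t ^ 2))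
        = ∫ t : ℝ, (G (σ + t * Complex.I)).re := by simp_rw [hGre]
      _ = (∫ t : ℝ, G (σ + t * Complex.I)).re := integral_re hGσ
      _ ≤ ‖∫ t : ℝ, G ((2 : ℝ) + t * Complex.I)‖ := by rw [hshift]; exact Complex.re_le_norm _
      _ ≤ ∫ t : ℝ, C₂ * (16 / 3) * T ^ (-(1 / 4) : ℝ) * (1 + |t|) ^ (-(5 / 4) : ℝ) := by
          refine norm_integral_le_of_norm_le (hpow.const_mul _) (Eventually.of_forall fun t => ?_)
          have h1 := hgn ((2 : ℝ) + t * Complex.I) (by simp; norm_num) (by simp) C₁ (by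
            simpa using hline t)
          have := hGb ((2 : ℝ) + t * Complex.I) (by simp; linarith) (by simp) C₂ hC₂0 h1
          simpa only [im_ofReal_add_mul_I] using this
      _ = _ := by rw [integral_const_mul]; ring
  have hgc : Continuous fun t : ℝ => g (σ + t * Complex.I) :=
    continuous_comp_vertical hg.continuousOn fun t => by simpa using hσ
  have hdom : Integrable fun t : ℝ => (h (σ + t * Complex.I)).re * (1 / (T ^ 2 + t ^ 2)) +
      (|C₀| + 8) * (4 * T ^ (-(1 / 4) : ℝ) * (1 + |t|) ^ (-(5 / 4) : ℝ)) :=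
    hint.add ((hpow.const_mul _).const_mul _)
  have hle : ∀ t : ℝ, |(g (σ + t * Complex.I)).re| * (1 / (T ^ 2 + t ^ 2)) ≤
      (h (σ + t * Complex.I)).re * (1 / (T ^ 2 + t ^ 2)) +
      (|C₀| + 8) * (4 * T ^ (-(1 / 4) : ℝ) * (1 + |t|) ^ (-(5 / 4) : ℝ)) := by
    intro t
    have h1 := hgh (σ + t * Complex.I) (by simpa using hσ) (by simp; linarith)
    rw [im_ofReal_add_mul_I] at h1
    have h2 := sqrt_div_sq_add_sq_le (T := T) (by linarith) t
    have h3 : 0 ≤ 1 / (T ^ 2 + t ^ 2) := by positivity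
    calc _ ≤ ((h (σ + t * Complex.I)).re + (|C₀| + 8) * √(1 + |t|)) * (1 / (T ^ 2 + t ^ 2)) := by
          gcongr
      _ = (h (σ + t * Complex.I)).re * (1 / (T ^ 2 + t ^ 2)) +
          (|C₀| + 8) * (√(1 + |t|) * (1 / (T ^ 2 + t ^ 2))) := by ring
      _ ≤ _ := by gcongr
  have hcont : Continuous fun t : ℝ => |(g (σ + t * Complex.I)).re| * (1 / (T ^ 2 + t ^ 2)) := by
    have h1 : ∀ t : ℝ, T ^ 2 + t ^ 2 ≠ 0 := fun t => by positivity
    have h2 := Complex.continuous_re.comp hgc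
    exact h2.abs.mul (continuous_const.div (by fun_prop) h1)
  have hI : Integrable fun t : ℝ => |(g (σ + t * Complex.I)).re| * (1 / (T ^ 2 + t ^ 2)) := by
    refine hdom.mono' hcont.aestronglyMeasurable (Eventually.of_forall fun t => ?_)
    rw [Real.norm_of_nonneg (by positivity)]
    exact hle t
  refine ⟨hI, (integral_mono hI hdom hle).trans ?_⟩
  rw [integral_add hint ((hpow.const_mul _).const_mul _), integral_const_mul, integral_const_mul]
  rw [← hA]
  linarith

lemma norm_perronWeight_le_of_le_abs {u σ T t : ℝ} (hu : 0 ≤ u) (hσ : 1 / 4 ≤ σ) (hT : 0 < T)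
    (ht : T ≤ |t|) :
    ‖perronWeight u (σ + t * Complex.I)‖ ≤
      250 * (Real.exp (u * σ) * (u + 1)) * (1 / (T ^ 2 + t ^ 2)) := by
  have h1 := norm_perronWeight_le hu (s := σ + t * Complex.I) (by simpa using hσ)
  rw [re_ofReal_add_mul_I, im_ofReal_add_mul_I, Real.rpow_neg (by positivity)] at h1
  have h2 : (T ^ 2 + t ^ 2) / 2 ≤ (1 + |t|) ^ (2 : ℝ) := by
    norm_num
    nlinarith [sq_abs t, abs_nonneg t]
  have h3 : ((1 + |t|) ^ (2 : ℝ))⁻¹ ≤ 2 * (1 / (T ^ 2 + t ^ 2)) := by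
    refine (inv_anti₀ (by positivity) h2).trans (le_of_eq ?_)
    field_simp
  refine h1.trans ?_
  calc _ ≤ 125 * (Real.exp (u * σ) * (u + 1)) * (2 * (1 / (T ^ 2 + t ^ 2))) := by gcongr
    _ = _ := by ring

lemma exists_norm_integral_le_truncated {g : ℂ → ℂ} {C₀ C₁ : ℝ}
    (hg : DifferentiableOn ℂ g {s : ℂ | 1 / 2 < s.re})
    (hre : ∀ s : ℂ, 1 / 2 < s.re → (g s).re ≤ C₀ + 2 * Real.log ‖s‖)
    (hline : ∀ t : ℝ, ‖g (2 + t * Complex.I)‖ ≤ C₁ * √(1 + |t|)) :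
    ∃ C : ℝ, 0 ≤ C ∧ ∀ u σ T : ℝ, 0 ≤ u → 1 / 2 < σ → σ ≤ 5 / 8 → 3 ≤ T →
      ‖∫ t : ℝ, g ((2 : ℝ) + t * Complex.I) * perronWeight u ((2 : ℝ) + t * Complex.I)‖ ≤
        2 * ‖∫ t in (-T)..T, (((g (σ + t * Complex.I)).re : ℝ) : ℂ) *
          perronWeight u (σ + t * Complex.I)‖ +
        C * (Real.exp (u * σ) * (u + 1)) * T ^ (-(1 / 4) : ℝ) +
        C * (Real.exp (u * (2 * σ - 3 / 4)) * (u + 1)) := by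
  obtain ⟨C₂, hC₂, htail⟩ := exists_tail_bound hg hre hline
  obtain ⟨C₃, hC₃, hC₃'⟩ := exists_norm_le_sqrt_of_re_le hg hre hline (δ := 1 / 4) (by norm_num)
  set A := ∫ t : ℝ, (1 + |t|) ^ (-(3 / 2) : ℝ) with hA
  have hA0 : 0 ≤ A := integral_nonneg fun t => by positivity
  have hpow : Integrable (fun t : ℝ => (1 + |t|) ^ (-(3 / 2) : ℝ)) :=
    integrable_one_add_abs_rpow (by norm_num)
  refine ⟨500 * C₂ + C₃ * 125 * A, by positivity, fun u σ T hu hσ hσ1 hT => ?_⟩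
  have hT0 : 0 < T := by linarith
  obtain ⟨B, hB0, hB⟩ := exists_norm_le_sqrt_of_re_le hg hre hline (δ := σ - 1 / 2) (by linarith)
  set F : ℂ → ℂ := fun s => g s * perronWeight u s with hF
  have hFd : DifferentiableOn ℂ F {s : ℂ | σ ≤ s.re ∧ s.re ≤ 2} := by
    refine (hg.mono fun s hs => hσ.trans_le hs.1).mul fun s hs => ?_
    exact (differentiableAt_perronWeight u (by linarith [hs.1])).differentiableWithinAt
  have hFb : ∀ s : ℂ, σ ≤ s.re → s.re ≤ 2 →
      ‖F s‖ ≤ B * (125 * (Real.exp (u * 2) * (u + 1))) * (1 + |s.im|) ^ (-(3 / 2) : ℝ) := by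
    intro s h1 h2
    refine (norm_mul_perronWeight_le hu (by linarith) hB0 (hB s (by linarith) h2)).trans ?_
    gcongr
  have hshift := integral_vertical_eq (a := σ) (b := 2) (r := 3 / 2) (by linarith) (by norm_num)
    hFd hFb
  have hFi : Integrable fun t : ℝ => F (σ + t * Complex.I) := by
    refine integrable_vertical (r := 3 / 2) (C := B * (125 * (Real.exp (u * 2) * (u + 1))))
      hFd.continuousOn (by norm_num) (fun t => ?_) (fun t => ?_)
    · simp; linarith
    · have := hFb (σ + t * Complex.I) (by simp) (by simp; linarith)
      simpa only [im_ofReal_add_mul_I] using this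
  set K : ℂ → ℂ := fun s => g s * perronWeight u (2 * σ - s) with hK
  have hre2 : ∀ s : ℂ, (2 * σ - s : ℂ).re = 2 * σ - s.re := by simp
  have him2 : ∀ s : ℂ, (2 * σ - s : ℂ).im = -s.im := by simp
  have hKd : DifferentiableOn ℂ K {s : ℂ | σ ≤ s.re ∧ s.re ≤ 3 / 4} := by
    refine (hg.mono fun s hs => hσ.trans_le hs.1).mul fun s hs => ?_
    have h1 := differentiableAt_perronWeight u (s := 2 * σ - s) (by rw [hre2]; linarith [hs.2])
    exact (h1.comp s (by fun_prop : DifferentiableAt ℂ (fun s : ℂ => 2 * (σ : ℂ) - s) s)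
      ).differentiableWithinAt
  have hKb : ∀ s : ℂ, σ ≤ s.re → s.re ≤ 3 / 4 → ∀ D : ℝ, 0 ≤ D → ‖g s‖ ≤ D * √(1 + |s.im|) →
      ‖K s‖ ≤ D * (125 * (Real.exp (u * (2 * σ - s.re)) * (u + 1))) *
        (1 + |s.im|) ^ (-(3 / 2) : ℝ) := by
    intro s h1 h2 D hD h3
    have := norm_mul_perronWeight_le hu (s := 2 * σ - s) (by rw [hre2]; linarith) hD (y := g s)
      (by rw [him2, abs_neg]; exact h3)
    rwa [him2, hre2, abs_neg] at this
  have hKb' : ∀ s : ℂ, σ ≤ s.re → s.re ≤ 3 / 4 →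
      ‖K s‖ ≤ B * (125 * (Real.exp (u * σ) * (u + 1))) * (1 + |s.im|) ^ (-(3 / 2) : ℝ) := by
    intro s h1 h2
    refine (hKb s h1 h2 B hB0 (hB s (by linarith) (by linarith))).trans ?_
    gcongr
    linarith
  have hshiftK := integral_vertical_eq (a := σ) (b := 3 / 4) (r := 3 / 2) (by linarith)
    (by norm_num) hKd hKb'
  have hKi : Integrable fun t : ℝ => K (σ + t * Complex.I) := by
    refine integrable_vertical (r := 3 / 2) (C := B * (125 * (Real.exp (u * σ) * (u + 1))))
      hKd.continuousOn (by norm_num) (fun t => ?_) (fun t => ?_)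
    · simp; linarith
    · have := hKb' (σ + t * Complex.I) (by simp) (by simp; linarith)
      simpa only [im_ofReal_add_mul_I] using this
  have hKbound : ‖∫ t : ℝ, K (σ + t * Complex.I)‖ ≤
      C₃ * 125 * A * (Real.exp (u * (2 * σ - 3 / 4)) * (u + 1)) := by
    rw [hshiftK]
    have : ∀ t : ℝ, ‖K ((3 / 4 : ℝ) + t * Complex.I)‖ ≤
        C₃ * (125 * (Real.exp (u * (2 * σ - 3 / 4)) * (u + 1))) * (1 + |t|) ^ (-(3 / 2) : ℝ) := by
      intro t
      have h1 : ((3 / 4 : ℝ) + t * Complex.I : ℂ).re = 3 / 4 := re_ofReal_add_mul_I _ _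
      have h2 : ((3 / 4 : ℝ) + t * Complex.I : ℂ).im = t := im_ofReal_add_mul_I _ _
      have := hKb ((3 / 4 : ℝ) + t * Complex.I) (by rw [h1]; linarith) h1.le C₃ hC₃
        (hC₃' _ (by rw [h1]; norm_num) (by rw [h1]; norm_num))
      rwa [h1, h2] at this
    refine (norm_integral_le_of_norm_le (hpow.const_mul _) (Eventually.of_forall this)).trans ?_
    rw [integral_const_mul, ← hA]
    linarith
  set W : ℝ → ℂ := fun t => (((g (σ + t * Complex.I)).re : ℝ) : ℂ) *
    perronWeight u (σ + t * Complex.I) with hW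
  have hconj : ∀ t : ℝ, F (σ + t * Complex.I) =
      2 * W t - (starRingEnd ℂ) (K (σ + t * Complex.I)) := by
    intro t
    have e : (2 * σ - (σ + t * Complex.I) : ℂ) = (starRingEnd ℂ) (σ + t * Complex.I) := by
      simp only [map_add, map_mul, Complex.conj_ofReal, Complex.conj_I]; ring
    simp only [hF, hK, hW]
    rw [e, ← conj_perronWeight, map_mul, Complex.conj_conj, Complex.re_eq_add_conj]
    ring
  have hKi' : Integrable fun t : ℝ => (starRingEnd ℂ) (K (σ + t * Complex.I)) := by
    refine hKi.congr' ?_ (Eventually.of_forall fun t => by simp)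
    exact Complex.continuous_conj.comp_aestronglyMeasurable hKi.aestronglyMeasurable
  have hWi : Integrable W := by
    have h1 := (hFi.add hKi').const_mul (1 / 2 : ℂ)
    refine h1.congr (Eventually.of_forall fun t => ?_)
    simp only [Pi.add_apply, hconj]
    ring
  have hJ : ∫ t : ℝ, F (σ + t * Complex.I) =
      2 * (∫ t, W t) - (starRingEnd ℂ) (∫ t : ℝ, K (σ + t * Complex.I)) := by
    simp_rw [hconj]
    rw [integral_sub (hWi.const_mul 2) hKi', integral_const_mul, integral_conj]
  have hsplit : ∫ t, W t = (∫ t in (-T)..T, W t) + ∫ t in (Ioc (-T) T)ᶜ, W t := by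
    rw [intervalIntegral.integral_of_le (by linarith), integral_add_compl measurableSet_Ioc hWi]
  obtain ⟨hI, hIb⟩ := htail σ T hσ (by linarith) hT
  have hcompl : ‖∫ t in (Ioc (-T) T)ᶜ, W t‖ ≤
      250 * (Real.exp (u * σ) * (u + 1)) * (C₂ * T ^ (-(1 / 4) : ℝ)) := by
    have h1 : ‖∫ t in (Ioc (-T) T)ᶜ, W t‖ ≤ ∫ t in (Ioc (-T) T)ᶜ,
        250 * (Real.exp (u * σ) * (u + 1)) *
          (|(g (σ + t * Complex.I)).re| * (1 / (T ^ 2 + t ^ 2))) := by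
      refine norm_integral_le_of_norm_le (hI.const_mul _).integrableOn ?_
      refine (ae_restrict_mem measurableSet_Ioc.compl).mono fun t ht => ?_
      have ht' : T ≤ |t| := by
        by_contra hlt
        push Not at hlt
        rw [abs_lt] at hlt
        exact ht ⟨hlt.1, hlt.2.le⟩
      have h2 := norm_perronWeight_le_of_le_abs hu (σ := σ) (by linarith) hT0 ht'
      rw [hW]
      simp only [norm_mul, Complex.norm_real, Real.norm_eq_abs]
      calc _ ≤ |(g (σ + t * Complex.I)).re| *
            (250 * (Real.exp (u * σ) * (u + 1)) * (1 / (T ^ 2 + t ^ 2))) := by gcongr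
        _ = _ := by ring
    refine h1.trans ?_
    refine (setIntegral_le_integral (hI.const_mul _)
      (Eventually.of_forall fun t => by positivity)).trans ?_
    rw [integral_const_mul]
    gcongr
  have hfin : ‖∫ t : ℝ, F ((2 : ℝ) + t * Complex.I)‖ ≤ 2 * (‖∫ t in (-T)..T, W t‖ +
      250 * (Real.exp (u * σ) * (u + 1)) * (C₂ * T ^ (-(1 / 4) : ℝ))) +
      C₃ * 125 * A * (Real.exp (u * (2 * σ - 3 / 4)) * (u + 1)) := by
    rw [← hshift, hJ]
    refine (norm_sub_le _ _).trans ?_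
    rw [norm_mul, Complex.norm_ofNat, Complex.norm_conj, hsplit]
    gcongr
    exact (norm_add_le _ _).trans (by gcongr)
  refine hfin.trans ?_
  have h1 : 0 ≤ C₃ * 125 * A * (Real.exp (u * σ) * (u + 1)) * T ^ (-(1 / 4) : ℝ) := by positivity
  have h2 : 0 ≤ 500 * C₂ * (Real.exp (u * (2 * σ - 3 / 4)) * (u + 1)) := by positivity
  linarith

lemma abs_log_le_abs_log {x y : ℝ} (hx : 0 < x) (hxy : x ≤ y) (hy : y ≤ 1) :
    |Real.log y| ≤ |Real.log x| := by
  rw [abs_of_nonpos (Real.log_nonpos (hx.trans_le hxy).le hy),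
    abs_of_nonpos (Real.log_nonpos hx.le (hxy.trans hy))]
  linarith [Real.log_le_log hx hxy]

lemma exists_nhds_abs_log_norm_le {Z : ℂ → ℂ} {p : ℂ} (hZ : AnalyticAt ℂ Z p)
    (hne : ¬∀ᶠ z in 𝓝 p, Z z = 0) :
    ∃ (m : ℕ) (C : ℝ), 0 ≤ C ∧ ∀ᶠ s in 𝓝 p, s.im ≠ p.im →
      Z s ≠ 0 ∧ |Real.log ‖Z s‖| ≤ m * |Real.log (s.im - p.im)| + C := by
  obtain ⟨m, h, hh, hh0, heq⟩ := hZ.exists_eventuallyEq_pow_smul_nonzero_iff.2 hne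
  have hc : ContinuousAt (fun s => Real.log ‖h s‖) p :=
    hh.continuousAt.norm.log (norm_ne_zero_iff.2 hh0)
  refine ⟨m, |Real.log ‖h p‖| + 1, by positivity, ?_⟩
  have h1 : ∀ᶠ s in 𝓝 p, |Real.log ‖h s‖| < |Real.log ‖h p‖| + 1 :=
    hc.abs.eventually_lt_const (lt_add_one _)
  filter_upwards [heq, h1, hh.continuousAt.eventually_ne hh0, Metric.ball_mem_nhds p one_pos]
    with s e h2 h3 h4 him
  have h5 : s - p ≠ 0 := fun h => him (by rw [sub_eq_zero.1 h])
  rw [mem_ball_iff_norm] at h4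
  have h6 : |s.im - p.im| ≤ ‖s - p‖ := by
    have := Complex.abs_im_le_norm (s - p)
    rwa [Complex.sub_im] at this
  have h7 : 0 < |s.im - p.im| := abs_pos.2 (sub_ne_zero.2 him)
  rw [e, smul_eq_mul]
  refine ⟨mul_ne_zero (pow_ne_zero _ h5) h3, ?_⟩
  rw [norm_mul, norm_pow, Real.log_mul (pow_ne_zero _ (norm_ne_zero_iff.2 h5))
    (norm_ne_zero_iff.2 h3), Real.log_pow]
  refine (abs_add_le _ _).trans ?_
  rw [abs_mul, Nat.abs_cast]
  have h8 := abs_log_le_abs_log h7 h6 h4.le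
  rw [Real.log_abs] at h8
  gcongr

lemma intervalIntegrable_abs_log_sub (c a b : ℝ) :
    IntervalIntegrable (fun t => |Real.log (t - c)|) volume a b := by
  have h := (intervalIntegral.intervalIntegrable_log' (a := a - c) (b := b - c)).comp_sub_right c
  simpa using h.abs

/-- Away from a null set of heights, `log ‖Z‖` is dominated on compact sets by an integrable
function of the height. -/
lemma exists_dominating_abs_log_norm {Z : ℂ → ℂ} (hZ : Differentiable ℂ Z) {z₀ : ℂ}
    (hz₀ : Z z₀ ≠ 0) {K : Set ℂ} (hK : IsCompact K) (a b : ℝ) :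
    ∃ B : ℝ → ℝ, IntervalIntegrable B volume a b ∧ (∀ t, 0 ≤ B t) ∧
      ∀ᵐ t : ℝ, ∀ σ : ℝ, (σ + t * Complex.I : ℂ) ∈ K →
        Z (σ + t * Complex.I) ≠ 0 ∧ |Real.log ‖Z (σ + t * Complex.I)‖| ≤ B t := by
  have hne : ∀ p : ℂ, ¬∀ᶠ z in 𝓝 p, Z z = 0 := by
    intro p hp
    have h1 : AnalyticOnNhd ℂ Z univ := fun z _ => hZ.analyticAt z
    have h2 := h1.eqOn_zero_of_preconnected_of_eventuallyEq_zero isPreconnected_univ (mem_univ p) hp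
    exact hz₀ (h2 (mem_univ z₀))
  refine hK.induction_on (p := fun K => ∃ B : ℝ → ℝ, IntervalIntegrable B volume a b ∧
    (∀ t, 0 ≤ B t) ∧ ∀ᵐ t : ℝ, ∀ σ : ℝ, (σ + t * Complex.I : ℂ) ∈ K →
        Z (σ + t * Complex.I) ≠ 0 ∧ |Real.log ‖Z (σ + t * Complex.I)‖| ≤ B t) ?_ ?_ ?_ ?_
  · exact ⟨fun _ => 0, by simp, fun _ => le_rfl, by simp⟩
  · rintro S S' hS ⟨B, h1, h2, h3⟩
    exact ⟨B, h1, h2, h3.mono fun t ht σ hσ => ht σ (hS hσ)⟩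
  · rintro S S' ⟨B, h1, h2, h3⟩ ⟨B', h1', h2', h3'⟩
    refine ⟨fun t => B t + B' t, h1.add h1', fun t => add_nonneg (h2 t) (h2' t), ?_⟩
    filter_upwards [h3, h3'] with t ht ht' σ hσ
    rcases hσ with hσ | hσ
    · exact ⟨(ht σ hσ).1, (ht σ hσ).2.trans (by linarith [h2' t])⟩
    · exact ⟨(ht' σ hσ).1, (ht' σ hσ).2.trans (by linarith [h2 t])⟩
  · intro p _
    obtain ⟨m, C, hC, hU⟩ := exists_nhds_abs_log_norm_le (hZ.analyticAt p) (hne p)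
    refine ⟨_, mem_nhdsWithin_of_mem_nhds hU, fun t => m * |Real.log (t - p.im)| + C, ?_, ?_, ?_⟩
    · exact ((intervalIntegrable_abs_log_sub _ _ _).const_mul _).add intervalIntegrable_const
    · intro t; positivity
    · have h0 : ∀ᵐ t : ℝ, t ≠ p.im := by
        simp [ae_iff, measure_singleton]
      filter_upwards [h0] with t ht σ hσ
      have hσ' : (σ + t * Complex.I : ℂ).im ≠ p.im →
        Z (σ + t * Complex.I) ≠ 0 ∧ |Real.log ‖Z (σ + t * Complex.I)‖| ≤
          m * |Real.log ((σ + t * Complex.I : ℂ).im - p.im)| + C := hσ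
      rw [im_ofReal_add_mul_I] at hσ'
      exact hσ' ht

lemma tendsto_integral_log_norm_perronWeight {Z : ℂ → ℂ} (hZ : Differentiable ℂ Z) {z₀ : ℂ}
    (hz₀ : Z z₀ ≠ 0) {u T : ℝ} (hu : 0 ≤ u) (hT : 0 ≤ T) :
    IntervalIntegrable (fun t : ℝ => Real.log ‖Z ((1 / 2 : ℝ) + t * Complex.I)‖) volume (-T) T ∧
    Tendsto (fun σ : ℝ => ∫ t in (-T)..T, ((Real.log ‖Z (σ + t * Complex.I)‖ : ℝ) : ℂ) *
      perronWeight u (σ + t * Complex.I)) (𝓝[>] (1 / 2))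
      (𝓝 (∫ t in (-T)..T, ((Real.log ‖Z ((1 / 2 : ℝ) + t * Complex.I)‖ : ℝ) : ℂ) *
        perronWeight u ((1 / 2 : ℝ) + t * Complex.I))) := by
  obtain ⟨B, hB, hB0, hB'⟩ := exists_dominating_abs_log_norm hZ hz₀
    ((isCompact_Icc (a := (1 / 2 : ℝ)) (b := 3 / 4)).reProdIm (isCompact_Icc (a := -T) (b := T)))
    (-T) T
  have hmem : ∀ σ t : ℝ, 1 / 2 ≤ σ → σ ≤ 3 / 4 → t ∈ uIoc (-T) T →
      (σ + t * Complex.I : ℂ) ∈ Icc (1 / 2 : ℝ) (3 / 4) ×ℂ Icc (-T) T := by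
    intro σ t h1 h2 h3
    rw [uIoc_of_le (by linarith)] at h3
    rw [Complex.mem_reProdIm, re_ofReal_add_mul_I, im_ofReal_add_mul_I]
    exact ⟨⟨h1, h2⟩, ⟨h3.1.le, h3.2⟩⟩
  have hmeas : ∀ σ : ℝ, Measurable fun t : ℝ => Real.log ‖Z (σ + t * Complex.I)‖ := by
    intro σ
    have : Continuous fun t : ℝ => Z (σ + t * Complex.I) := hZ.continuous.comp (by fun_prop)
    exact Real.measurable_log.comp this.norm.measurable
  constructor
  · refine hB.mono_fun (hmeas _).aestronglyMeasurable ?_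
    rw [EventuallyLE, ae_restrict_iff' measurableSet_uIoc]
    filter_upwards [hB'] with t ht htT
    rw [Real.norm_eq_abs, Real.norm_of_nonneg (hB0 t)]
    exact (ht _ (hmem _ t le_rfl (by norm_num) htT)).2
  · have hev : ∀ᶠ σ : ℝ in 𝓝[>] (1 / 2), 1 / 2 < σ ∧ σ ≤ 3 / 4 := by
      have h1 : Ioc (1 / 2 : ℝ) (3 / 4) ∈ 𝓝[>] (1 / 2) := Ioc_mem_nhdsGT (by norm_num)
      exact h1
    refine intervalIntegral.tendsto_integral_filter_of_dominated_convergence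
      (fun t => B t * (125 * (Real.exp u * (u + 1)))) ?_ ?_ (hB.mul_const _) ?_
    · filter_upwards [hev] with σ hσ
      have hc : Continuous fun t : ℝ => perronWeight u (σ + t * Complex.I) := by
        refine continuous_comp_vertical (S := {s : ℂ | 0 < s.re}) (fun s hs => ?_) (fun t => ?_)
        · exact (differentiableAt_perronWeight u hs).continuousAt.continuousWithinAt
        · show 0 < (σ + t * Complex.I : ℂ).re
          rw [re_ofReal_add_mul_I]; linarith
      exact ((Complex.measurable_ofReal.comp (hmeas σ)).mul hc.measurable).aestronglyMeasurable
    · filter_upwards [hev] with σ hσ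
      filter_upwards [hB'] with t ht htT
      have h1 := (ht σ (hmem σ t hσ.1.le hσ.2 htT)).2
      have h2 := norm_perronWeight_le hu (s := σ + t * Complex.I)
        (by rw [re_ofReal_add_mul_I]; linarith)
      rw [re_ofReal_add_mul_I, im_ofReal_add_mul_I] at h2
      have h3 : (1 + |t|) ^ (-2 : ℝ) ≤ 1 :=
        Real.rpow_le_one_of_one_le_of_nonpos (by linarith [abs_nonneg t]) (by norm_num)
      have h4 : u * σ ≤ u := mul_le_of_le_one_right hu (by linarith [hσ.2])
      rw [norm_mul, Complex.norm_real, Real.norm_eq_abs]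
      have := hB0 t
      gcongr
      refine h2.trans ?_
      calc _ ≤ 125 * (Real.exp u * (u + 1)) * 1 := by gcongr
        _ = _ := mul_one _
    · filter_upwards [hB'] with t ht htT
      have h1 := (ht (1 / 2) (hmem _ t le_rfl (by norm_num) htT)).1
      have hL : ContinuousAt (fun σ : ℝ => (σ + t * Complex.I : ℂ)) (1 / 2 : ℝ) := by fun_prop
      have h2 : ContinuousAt (fun σ : ℝ => ((Real.log ‖Z (σ + t * Complex.I)‖ : ℝ) : ℂ) *
          perronWeight u (σ + t * Complex.I)) (1 / 2 : ℝ) := by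
        refine ContinuousAt.mul ?_ ?_
        · have h3 : ContinuousAt (fun σ : ℝ => ‖Z (σ + t * Complex.I)‖) (1 / 2 : ℝ) :=
            (hZ.continuous.continuousAt.comp hL).norm
          exact Complex.continuous_ofReal.continuousAt.comp (h3.log (norm_ne_zero_iff.2 h1))
        · have h4 : ContinuousAt (perronWeight u) (((1 / 2 : ℝ) : ℂ) + t * Complex.I) :=
            (differentiableAt_perronWeight u (by
              rw [re_ofReal_add_mul_I]; norm_num)).continuousAt
          exact ContinuousAt.comp (f := fun σ : ℝ => (σ + t * Complex.I : ℂ)) h4 hL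
      exact h2.tendsto.mono_left nhdsWithin_le_nhds

lemma tendsto_integral_exp_mul_I (f : ℝ → ℂ) :
    Tendsto (fun u : ℝ => ∫ t : ℝ, Complex.exp (u * t * Complex.I) * f t) atTop (𝓝 0) := by
  have h1 := Real.tendsto_integral_exp_smul_cocompact f
  have h2 : Tendsto (fun u : ℝ => u * (-(2 * Real.pi)⁻¹)) atTop (cocompact ℝ) := by
    refine Tendsto.mono_right ?_ atBot_le_cocompact
    exact tendsto_id.atTop_mul_const_of_neg (by simp [Real.pi_pos])
  refine (h1.comp h2).congr fun u => ?_
  refine integral_congr_ae (Eventually.of_forall fun t => ?_)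
  simp only [Circle.smul_def, Real.fourierChar_apply, smul_eq_mul]
  congr 2
  have : (Real.pi : ℂ) ≠ 0 := by exact_mod_cast Real.pi_ne_zero
  push_cast
  field_simp

lemma intervalIntegrable_ofReal_mul {φ : ℝ → ℝ} {a b : ℝ} (hφ : IntervalIntegrable φ volume a b)
    {G : ℝ → ℂ} (hG : Continuous G) :
    IntervalIntegrable (fun t : ℝ => ((φ t : ℝ) : ℂ) * G t) volume a b := by
  have h : IntervalIntegrable (fun t : ℝ => ((φ t : ℝ) : ℂ)) volume a b :=
    ⟨hφ.1.ofReal, hφ.2.ofReal⟩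
  exact h.mul_continuousOn hG.continuousOn

/-- The contour integral of `g` against the Perron weight is `o(u exp(u / 2))`. -/
lemma eventually_norm_integral_mul_perronWeight_le {g Z : ℂ → ℂ} {C₀ C₁ : ℝ}
    (hg : DifferentiableOn ℂ g {s : ℂ | 1 / 2 < s.re})
    (hre : ∀ s : ℂ, 1 / 2 < s.re → (g s).re ≤ C₀ + 2 * Real.log ‖s‖)
    (hline : ∀ t : ℝ, ‖g (2 + t * Complex.I)‖ ≤ C₁ * √(1 + |t|))
    (hZ : Differentiable ℂ Z) (hexp : ∀ s : ℂ, 1 / 2 < s.re → Complex.exp (g s) = Z s)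
    {ε : ℝ} (hε : 0 < ε) :
    ∀ᶠ u : ℝ in atTop,
      ‖∫ t : ℝ, g ((2 : ℝ) + t * Complex.I) * perronWeight u ((2 : ℝ) + t * Complex.I)‖ ≤
        ε * (u * Real.exp (u / 2)) := by
  obtain ⟨C, hC, hmain⟩ := exists_norm_integral_le_truncated hg hre hline
  have hz₀ : Z 1 ≠ 0 := by
    rw [← hexp 1 (by norm_num)]; exact Complex.exp_ne_zero _
  obtain ⟨T, hT3, hT⟩ : ∃ T : ℝ, 3 ≤ T ∧ C * T ^ (-(1 / 4) : ℝ) ≤ ε / 8 := by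
    have h1 : Tendsto (fun T : ℝ => C * T ^ (-(1 / 4) : ℝ)) atTop (𝓝 (C * 0)) :=
      (tendsto_rpow_neg_atTop (by norm_num)).const_mul C
    rw [mul_zero] at h1
    exact ((eventually_ge_atTop 3).and (h1.eventually_le_const (by positivity))).exists
  have hT0 : 0 ≤ T := by linarith
  have hre' : ∀ s : ℂ, 1 / 2 < s.re → (g s).re = Real.log ‖Z s‖ := by
    intro s hs
    rw [← hexp s hs, Complex.norm_exp, Real.log_exp]
  set φ : ℝ → ℝ := fun t => Real.log ‖Z ((1 / 2 : ℝ) + t * Complex.I)‖ with hφ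
  have hφi : IntervalIntegrable φ volume (-T) T :=
    (tendsto_integral_log_norm_perronWeight hZ hz₀ le_rfl hT0).1
  have hlim : ∀ u : ℝ, 0 ≤ u →
      ‖∫ t : ℝ, g ((2 : ℝ) + t * Complex.I) * perronWeight u ((2 : ℝ) + t * Complex.I)‖ ≤
        2 * ‖∫ t in (-T)..T, (φ t : ℂ) * perronWeight u ((1 / 2 : ℝ) + t * Complex.I)‖ +
        C * (Real.exp (u * (1 / 2)) * (u + 1)) * T ^ (-(1 / 4) : ℝ) +
        C * (Real.exp (u * (2 * (1 / 2) - 3 / 4)) * (u + 1)) := by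
    intro u hu
    have h1 := (tendsto_integral_log_norm_perronWeight hZ hz₀ hu hT0).2
    have h2 : Tendsto (fun σ : ℝ => C * (Real.exp (u * σ) * (u + 1)) * T ^ (-(1 / 4) : ℝ) +
        C * (Real.exp (u * (2 * σ - 3 / 4)) * (u + 1))) (𝓝[>] (1 / 2))
        (𝓝 (C * (Real.exp (u * (1 / 2)) * (u + 1)) * T ^ (-(1 / 4) : ℝ) +
        C * (Real.exp (u * (2 * (1 / 2) - 3 / 4)) * (u + 1)))) := by
      refine Tendsto.mono_left (Continuous.tendsto ?_ _) nhdsWithin_le_nhds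
      fun_prop
    have h3 := (h1.norm.const_mul 2).add h2
    rw [add_assoc]
    refine ge_of_tendsto h3 ?_
    have h4 : Ioc (1 / 2 : ℝ) (5 / 8) ∈ 𝓝[>] (1 / 2) := Ioc_mem_nhdsGT (by norm_num)
    filter_upwards [h4] with σ hσ
    have h5 := hmain u σ T hu hσ.1 hσ.2 hT3
    rw [add_assoc] at h5
    have h6 : ∀ t : ℝ, (g (σ + t * Complex.I)).re = Real.log ‖Z (σ + t * Complex.I)‖ :=
      fun t => hre' _ (by rw [re_ofReal_add_mul_I]; exact hσ.1)
    simp only [h6] at h5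
    exact h5
  have hcont : ∀ G : ℂ → ℂ, (∀ s : ℂ, 0 < s.re → ContinuousAt G s) →
      Continuous fun t : ℝ => G ((1 / 2 : ℝ) + t * Complex.I) := by
    intro G hG
    refine continuous_comp_vertical (S := {s : ℂ | 0 < s.re})
      (fun s hs => (hG s hs).continuousWithinAt) (fun t => ?_)
    show 0 < (((1 / 2 : ℝ) : ℂ) + t * Complex.I : ℂ).re
    rw [re_ofReal_add_mul_I]; norm_num
  have hk : Continuous fun t : ℝ => perronKernel ((1 / 2 : ℝ) + t * Complex.I) :=
    hcont _ fun s hs => (hasDerivAt_perronKernel hs).continuousAt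
  have hk' : Continuous fun t : ℝ => perronKernelDeriv ((1 / 2 : ℝ) + t * Complex.I) :=
    hcont _ fun s hs => by
      have h0 := ne_zero_of_re_pos hs
      have h1 := add_one_ne_zero_of_re_pos hs
      have h3 : (s * (s + 1)) ^ 2 ≠ 0 := pow_ne_zero _ (mul_ne_zero h0 h1)
      have : DifferentiableAt ℂ perronKernelDeriv s := by
        unfold perronKernelDeriv
        fun_prop (disch := assumption)
      exact this.continuousAt
  have hRL : ∀ G : ℂ → ℂ, Continuous (fun t : ℝ => G ((1 / 2 : ℝ) + t * Complex.I)) →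
      Tendsto (fun u : ℝ => ∫ t in (-T)..T, Complex.exp (u * t * Complex.I) *
        (φ t * G ((1 / 2 : ℝ) + t * Complex.I))) atTop (𝓝 0) := by
    intro G hG
    refine (tendsto_integral_exp_mul_I ((Ioc (-T) T).indicator fun t : ℝ =>
      (φ t : ℂ) * G ((1 / 2 : ℝ) + t * Complex.I))).congr fun u => ?_
    rw [intervalIntegral.integral_of_le (by linarith), ← integral_indicator measurableSet_Ioc]
    refine integral_congr_ae (Eventually.of_forall fun t => ?_)
    by_cases ht : t ∈ Ioc (-T) T
    · simp [ht]
    · simp [ht]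
  have hI : ∀ u : ℝ, ∫ t in (-T)..T, (φ t : ℂ) * perronWeight u ((1 / 2 : ℝ) + t * Complex.I) =
      Complex.exp (u / 2) * (u * (∫ t in (-T)..T, Complex.exp (u * t * Complex.I) *
        (φ t * perronKernel ((1 / 2 : ℝ) + t * Complex.I))) +
        ∫ t in (-T)..T, Complex.exp (u * t * Complex.I) *
        (φ t * perronKernelDeriv ((1 / 2 : ℝ) + t * Complex.I))) := by
    intro u
    have hint : ∀ G : ℂ → ℂ, Continuous (fun t : ℝ => G ((1 / 2 : ℝ) + t * Complex.I)) →
        IntervalIntegrable (fun t : ℝ => Complex.exp (u * t * Complex.I) *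
        (φ t * G ((1 / 2 : ℝ) + t * Complex.I))) volume (-T) T := fun G hG =>
      (intervalIntegrable_ofReal_mul hφi hG).continuousOn_mul
        (by fun_prop : Continuous fun t : ℝ => Complex.exp (u * t * Complex.I)).continuousOn
    rw [← intervalIntegral.integral_const_mul, ← intervalIntegral.integral_add
      ((hint _ hk).const_mul _) (hint _ hk'), ← intervalIntegral.integral_const_mul]
    refine intervalIntegral.integral_congr fun t _ => ?_
    simp only [perronWeight]
    have e : Complex.exp (u * ((1 / 2 : ℝ) + t * Complex.I)) =
        Complex.exp (u / 2) * Complex.exp (u * t * Complex.I) := by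
      rw [← Complex.exp_add]; congr 1; push_cast; ring
    rw [e]; ring
  have hev1 := (hRL _ hk).norm.eventually_le_const (show ‖(0 : ℂ)‖ < ε / 8 by simpa using hε)
  have hev2 := (hRL _ hk').norm.eventually_le_const (show ‖(0 : ℂ)‖ < 1 by simp)
  have hsmall : Tendsto (fun u : ℝ => C * 2 * Real.exp (-(u / 4))) atTop (𝓝 (C * 2 * 0)) := by
    refine Tendsto.const_mul _ (Real.tendsto_exp_neg_atTop_nhds_zero.comp ?_)
    exact tendsto_id.atTop_div_const (by norm_num)
  rw [mul_zero] at hsmall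
  filter_upwards [hev1, hev2, eventually_ge_atTop 1, eventually_ge_atTop (16 / ε),
    hsmall.eventually_le_const (show (0 : ℝ) < ε / 8 by positivity)] with u h1 h2 hu1 huε h3
  have hu0 : 0 ≤ u := by linarith
  refine (hlim u hu0).trans ?_
  set E := Real.exp (u / 2) with hE
  have hE0 : 0 < E := Real.exp_pos _
  have hexp2 : ‖Complex.exp (u / 2)‖ = E := by
    rw [Complex.norm_exp]; simp [hE]
  have hA : ‖∫ t in (-T)..T, (φ t : ℂ) * perronWeight u ((1 / 2 : ℝ) + t * Complex.I)‖ ≤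
      E * (u * (ε / 8) + 1) := by
    rw [hI, norm_mul, hexp2]
    gcongr
    refine (norm_add_le _ _).trans (add_le_add ?_ h2)
    rw [norm_mul, Complex.norm_real, Real.norm_of_nonneg hu0]
    gcongr
  have hB : C * (Real.exp (u * (1 / 2)) * (u + 1)) * T ^ (-(1 / 4) : ℝ) ≤ E * (2 * u) * (ε / 8) := by
    have e : Real.exp (u * (1 / 2)) = E := by rw [hE]; congr 1; ring
    rw [e]
    calc _ = E * (u + 1) * (C * T ^ (-(1 / 4) : ℝ)) := by ring
      _ ≤ _ := by gcongr; linarith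
  have hD : C * (Real.exp (u * (2 * (1 / 2) - 3 / 4)) * (u + 1)) ≤ E * u * (ε / 8) := by
    have e : Real.exp (u * (2 * (1 / 2) - 3 / 4)) = E * Real.exp (-(u / 4)) := by
      rw [hE, ← Real.exp_add]; congr 1; ring
    rw [e]
    calc _ ≤ C * (E * Real.exp (-(u / 4)) * (2 * u)) := by gcongr; linarith
      _ = E * u * (C * 2 * Real.exp (-(u / 4))) := by ring
      _ ≤ _ := by gcongr
  have h16 : 16 ≤ u * ε := by rwa [div_le_iff₀ hε] at huε
  nlinarith [mul_le_mul_of_nonneg_left h16 hE0.le]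

/-- The error term `ψ(t) - (t - 1)` in the prime number theorem, normalised to vanish at `1`. -/
noncomputable def psiError (t : ℝ) : ℝ := Chebyshev.psi t - (t - 1)

/-- The primitive of `psiError` that vanishes at `1`. -/
noncomputable def psiErrorPrimitive (x : ℝ) : ℝ := ∫ t in (1 : ℝ)..x, psiError t

theorem intervalIntegrable_psiError (a b : ℝ) : IntervalIntegrable psiError volume a b := by
  refine (Chebyshev.psi_mono.intervalIntegrable).sub ?_
  exact (by fun_prop : Continuous fun t : ℝ => t - 1).intervalIntegrable a b

theorem continuous_psiErrorPrimitive : Continuous psiErrorPrimitive :=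
  intervalIntegral.continuous_primitive intervalIntegrable_psiError 1

theorem measurable_psiError : Measurable psiError :=
  Chebyshev.psi_mono.measurable.sub (by fun_prop)

theorem continuousWithinAt_psiError {x : ℝ} (hx : 0 ≤ x) :
    ContinuousWithinAt psiError (Ioi x) x := by
  have hpsi : ContinuousWithinAt Chebyshev.psi (Ioi x) x := by
    refine continuousWithinAt_const (b := Chebyshev.psi x).congr_of_eventuallyEq ?_ rfl
    filter_upwards [Ioo_mem_nhdsGT (Nat.lt_floor_add_one x)] with y hy
    rw [Chebyshev.psi_eq_psi_coe_floor y, Chebyshev.psi_eq_psi_coe_floor x]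
    congr 2
    rw [Nat.floor_eq_iff (hx.trans hy.1.le)]
    exact ⟨(Nat.floor_le hx).trans hy.1.le, hy.2⟩
  exact hpsi.sub (by fun_prop)

theorem hasDerivWithinAt_psiErrorPrimitive {x : ℝ} (hx : 0 ≤ x) :
    HasDerivWithinAt psiErrorPrimitive (psiError x) (Ioi x) x :=
  intervalIntegral.integral_hasDerivWithinAt_right (intervalIntegrable_psiError 1 x)
    (s := Ici x) (t := Ioi x) measurable_psiError.stronglyMeasurable.stronglyMeasurableAtFilter
    (continuousWithinAt_psiError hx) |>.mono Ioi_subset_Ici_self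

theorem abs_psiError_le {t : ℝ} (ht : 1 ≤ t) : |psiError t| ≤ 6 * t := by
  have h1 := Chebyshev.psi_le_const_mul_self (by linarith : 0 ≤ t)
  have h2 := Chebyshev.psi_nonneg t
  have h4 : Real.log 4 ≤ 2 := by
    rw [show (4 : ℝ) = 2 ^ 2 by norm_num, Real.log_pow]
    have := Real.log_two_lt_d9
    push_cast; linarith
  rw [psiError, abs_le]
  constructor <;> nlinarith

theorem abs_psiErrorPrimitive_le {x : ℝ} (hx : 1 ≤ x) : |psiErrorPrimitive x| ≤ 6 * x ^ 2 := by
  have h := intervalIntegral.norm_integral_le_of_norm_le_const (a := 1) (b := x) (f := psiError)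
    (C := 6 * x) (by
      intro t ht
      rw [uIoc_of_le hx] at ht
      rw [Real.norm_eq_abs]
      exact (abs_psiError_le ht.1.le).trans (by linarith [ht.2]))
  rw [Real.norm_eq_abs, abs_of_nonneg (by linarith : 0 ≤ x - 1)] at h
  exact h.trans (by nlinarith)

theorem psiErrorPrimitive_one : psiErrorPrimitive 1 = 0 := intervalIntegral.integral_same

theorem integral_psiError_mul {a b : ℝ} (ha : 0 ≤ a) (hab : a ≤ b) {φ φ' : ℝ → ℝ}
    (hφ : ∀ t ∈ Icc a b, HasDerivAt φ (φ' t) t) (hφ' : ContinuousOn φ' (Icc a b)) :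
    ∫ t in a..b, psiError t * φ t = psiErrorPrimitive b * φ b - psiErrorPrimitive a * φ a -
      ∫ t in a..b, psiErrorPrimitive t * φ' t := by
  have h := intervalIntegral.integral_mul_deriv_eq_deriv_mul_of_hasDeriv_right
    (a := a) (b := b) (u := psiErrorPrimitive) (v := φ) (u' := psiError) (v' := φ')
    continuous_psiErrorPrimitive.continuousOn
    (by
      rw [uIcc_of_le hab]
      exact fun t ht => (hφ t ht).continuousAt.continuousWithinAt)
    (by
      rw [min_eq_left hab]
      exact fun t ht => hasDerivWithinAt_psiErrorPrimitive (ha.trans ht.1.le))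
    (by
      rw [min_eq_left hab, max_eq_right hab]
      exact fun t ht => (hφ t (Ioo_subset_Icc_self ht)).hasDerivWithinAt)
    (intervalIntegrable_psiError a b)
    (ContinuousOn.intervalIntegrable (by rwa [uIcc_of_le hab]))
  linarith

theorem integral_psiError_mul_complex {a b : ℝ} (ha : 0 ≤ a) (hab : a ≤ b) {φ φ' : ℝ → ℂ}
    (hφ : ∀ t ∈ Icc a b, HasDerivAt φ (φ' t) t) (hφ' : ContinuousOn φ' (Icc a b)) :
    ∫ t in a..b, (psiError t : ℂ) * φ t =
      psiErrorPrimitive b * φ b - psiErrorPrimitive a * φ a -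
        ∫ t in a..b, (psiErrorPrimitive t : ℂ) * φ' t := by
  have h := intervalIntegral.integral_mul_deriv_eq_deriv_mul_of_hasDeriv_right
    (a := a) (b := b) (u := fun t => (psiErrorPrimitive t : ℂ)) (v := φ)
    (u' := fun t => (psiError t : ℂ)) (v' := φ')
    (Complex.continuous_ofReal.comp continuous_psiErrorPrimitive).continuousOn
    (by
      rw [uIcc_of_le hab]
      exact fun t ht => (hφ t ht).continuousAt.continuousWithinAt)
    (by
      rw [min_eq_left hab]
      exact fun t ht => (hasDerivWithinAt_psiErrorPrimitive (ha.trans ht.1.le)).ofReal_comp)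
    (by
      rw [min_eq_left hab, max_eq_right hab]
      exact fun t ht => (hφ t (Ioo_subset_Icc_self ht)).hasDerivWithinAt)
    ⟨(intervalIntegrable_psiError a b).1.ofReal, (intervalIntegrable_psiError a b).2.ofReal⟩
    (ContinuousOn.intervalIntegrable (by rwa [uIcc_of_le hab]))
  linear_combination h

theorem integrableOn_Ioi_one_mul_cpow {f : ℝ → ℝ} (hf : Measurable f) {C : ℝ} {r : ℝ}
    (hb : ∀ t, 1 ≤ t → |f t| ≤ C * t ^ r) {w : ℂ} (hw : r + w.re < -1) :
    IntegrableOn (fun t : ℝ => (f t : ℂ) * (t : ℂ) ^ w) (Ioi 1) := by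
  refine Integrable.mono' (g := fun t => C * t ^ (r + w.re))
    ((integrableOn_Ioi_rpow_of_lt hw one_pos).const_mul C) ?_ ?_
  · exact (by fun_prop : Measurable fun t : ℝ => (f t : ℂ) * (t : ℂ) ^ w).aestronglyMeasurable
  · refine (ae_restrict_iff' measurableSet_Ioi).2 (Eventually.of_forall fun t ht => ?_)
    have ht0 : (0 : ℝ) < t := one_pos.trans ht
    rw [norm_mul, Complex.norm_cpow_eq_rpow_re_of_pos ht0, Complex.norm_real, Real.norm_eq_abs,
      Real.rpow_add ht0, ← mul_assoc]
    exact mul_le_mul_of_nonneg_right (hb t (le_of_lt ht)) (by positivity)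

theorem integrableOn_psiError_mul_cpow {w : ℂ} (hw : w.re < -2) :
    IntegrableOn (fun t : ℝ => (psiError t : ℂ) * (t : ℂ) ^ w) (Ioi 1) :=
  integrableOn_Ioi_one_mul_cpow measurable_psiError (r := 1) (C := 6)
    (fun t ht => by rw [Real.rpow_one]; exact abs_psiError_le ht) (by linarith)

theorem integrableOn_psiErrorPrimitive_mul_cpow {w : ℂ} (hw : w.re < -3) :
    IntegrableOn (fun t : ℝ => (psiErrorPrimitive t : ℂ) * (t : ℂ) ^ w) (Ioi 1) :=
  integrableOn_Ioi_one_mul_cpow continuous_psiErrorPrimitive.measurable (r := 2) (C := 6)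
    (fun t ht => by rw [Real.rpow_two]; exact abs_psiErrorPrimitive_le ht) (by linarith)

theorem integral_psiError_mul_cpow {w : ℂ} (hw : w.re < -2) :
    ∫ t in Ioi (1 : ℝ), (psiError t : ℂ) * (t : ℂ) ^ w =
      -w * ∫ t in Ioi (1 : ℝ), (psiErrorPrimitive t : ℂ) * (t : ℂ) ^ (w - 1) := by
  have hw1 : (w - 1).re < -3 := by rw [Complex.sub_re, Complex.one_re]; linarith
  have hw0 : w ≠ 0 := fun h => by rw [h] at hw; norm_num at hw
  have h1 := intervalIntegral_tendsto_integral_Ioi 1 (integrableOn_psiError_mul_cpow hw) tendsto_id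
  have h2 := (intervalIntegral_tendsto_integral_Ioi 1
    (integrableOn_psiErrorPrimitive_mul_cpow hw1) tendsto_id).const_mul (-w)
  have h3 : Tendsto (fun b : ℝ => (psiErrorPrimitive b : ℂ) * (b : ℂ) ^ w) atTop (𝓝 0) := by
    have h4 : Tendsto (fun b : ℝ => 6 * b ^ (-(-(2 + w.re)))) atTop (𝓝 (6 * 0)) :=
      (tendsto_rpow_neg_atTop (by linarith)).const_mul 6
    rw [mul_zero] at h4
    refine squeeze_zero_norm' ?_ h4
    filter_upwards [eventually_ge_atTop 1] with b hb
    have hb0 : (0 : ℝ) < b := one_pos.trans_le hb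
    rw [norm_mul, Complex.norm_cpow_eq_rpow_re_of_pos hb0, Complex.norm_real, Real.norm_eq_abs,
      neg_neg, Real.rpow_add hb0, ← mul_assoc, Real.rpow_two]
    exact mul_le_mul_of_nonneg_right (abs_psiErrorPrimitive_le hb) (by positivity)
  refine tendsto_nhds_unique h1 (((h3.add h2).congr' ?_).trans (by rw [zero_add]))
  filter_upwards [eventually_ge_atTop 1] with b hb
  have hpos : ∀ t ∈ Icc 1 b, (t : ℂ) ∈ Complex.slitPlane := fun t ht =>
    Complex.ofReal_mem_slitPlane.2 (one_pos.trans_le ht.1)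
  have key := integral_psiError_mul_complex zero_le_one hb (φ := fun t => (t : ℂ) ^ w)
    (φ' := fun t => w * (t : ℂ) ^ (w - 1))
    (fun t ht => by
      simpa using (hasDerivAt_id (t : ℂ)).cpow_const (c := w) (hpos t ht) |>.comp_ofReal)
    (fun t ht => by
      refine ContinuousAt.continuousWithinAt ?_
      exact continuousAt_const.mul
        (((hasDerivAt_id (t : ℂ)).cpow_const (c := w - 1) (hpos t ht)).continuousAt.comp
          Complex.continuous_ofReal.continuousAt))
  simp only [id]
  have hcomm : ∫ t in (1 : ℝ)..b, (psiErrorPrimitive t : ℂ) * (w * (t : ℂ) ^ (w - 1)) =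
      w * ∫ t in (1 : ℝ)..b, (psiErrorPrimitive t : ℂ) * (t : ℂ) ^ (w - 1) := by
    rw [← intervalIntegral.integral_const_mul]
    exact intervalIntegral.integral_congr fun t _ => by ring
  rw [key, psiErrorPrimitive_one, hcomm, Complex.ofReal_zero]
  ring

theorem mul_integral_psiError_mul_cpow {s : ℂ} (hs : s.re = 2) :
    s * ∫ t in Ioi (1 : ℝ), (psiError t : ℂ) * (t : ℂ) ^ (-(s + 1)) =
      -deriv riemannZeta s / riemannZeta s - 1 / (s - 1) := by
  have hs0 : s ≠ 0 := fun h => by rw [h] at hs; norm_num at hs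
  have hs1 : s - 1 ≠ 0 := fun h => by
    rw [sub_eq_zero.1 h] at hs; norm_num at hs
  have hL := LSeries_eq_mul_integral_of_nonneg (fun n => ArithmeticFunction.vonMangoldt n)
    zero_le_one (s := s) (by rw [hs]; norm_num) (by
      refine Asymptotics.IsBigO.of_bound (Real.log 4 + 4) (Eventually.of_forall fun n => ?_)
      have h1 := Chebyshev.psi_le_const_mul_self (Nat.cast_nonneg (α := ℝ) n)
      have h2 := Chebyshev.psi_nonneg n
      rw [Chebyshev.psi, Nat.floor_natCast] at h1 h2
      rw [Real.rpow_one, Real.norm_eq_abs, Real.norm_eq_abs, Nat.abs_cast]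
      rw [← Finset.Icc_add_one_left_eq_Ioc, zero_add] at h1 h2
      rwa [abs_of_nonneg h2])
    (fun n => ArithmeticFunction.vonMangoldt_nonneg)
  rw [ArithmeticFunction.LSeries_vonMangoldt_eq_deriv_riemannZeta_div (by rw [hs]; norm_num)] at hL
  have hre : (-(s + 1)).re = -3 := by simp [hs]; norm_num
  have hi1 := integral_Ioi_cpow_of_lt (a := -(s + 1) + 1) (c := 1)
    (by rw [Complex.add_re, hre]; norm_num) one_pos
  have hi2 := integral_Ioi_cpow_of_lt (a := -(s + 1)) (c := 1) (by rw [hre]; norm_num) one_pos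
  have hint1 := integrableOn_Ioi_cpow_of_lt (a := -(s + 1) + 1) (c := 1)
    (by rw [Complex.add_re, hre]; norm_num) one_pos
  have hint2 := integrableOn_Ioi_cpow_of_lt (a := -(s + 1)) (c := 1)
    (by rw [hre]; norm_num) one_pos
  have herr := integrableOn_psiError_mul_cpow (w := -(s + 1)) (by rw [hre]; norm_num)
  have hsplit : ∫ t in Ioi (1 : ℝ), (∑ k ∈ Finset.Icc 1 ⌊t⌋₊,
      ((ArithmeticFunction.vonMangoldt k : ℝ) : ℂ)) * (t : ℂ) ^ (-(s + 1)) =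
      (∫ t in Ioi (1 : ℝ), (psiError t : ℂ) * (t : ℂ) ^ (-(s + 1))) +
        ((∫ t in Ioi (1 : ℝ), (t : ℂ) ^ (-(s + 1) + 1)) -
          ∫ t in Ioi (1 : ℝ), (t : ℂ) ^ (-(s + 1))) := by
    rw [← integral_sub hint1 hint2]
    refine Eq.trans ?_ (integral_add herr (hint1.sub hint2))
    refine setIntegral_congr_fun measurableSet_Ioi fun t ht => ?_
    have ht0 : (t : ℂ) ≠ 0 := Complex.ofReal_ne_zero.2 (one_pos.trans ht).ne'
    have hpsi : (∑ k ∈ Finset.Icc 1 ⌊t⌋₊, ((ArithmeticFunction.vonMangoldt k : ℝ) : ℂ)) =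
        (Chebyshev.psi t : ℂ) := by
      rw [Chebyshev.psi, ← Finset.Icc_add_one_left_eq_Ioc, zero_add, Complex.ofReal_sum]
    simp only [hpsi, psiError]
    rw [Complex.cpow_add _ _ ht0, Complex.cpow_one]
    push_cast
    ring
  rw [hsplit, hi1, hi2, Complex.ofReal_one, Complex.one_cpow, Complex.one_cpow] at hL
  have e1 : -(s + 1) + 1 + 1 = -(s - 1) := by ring
  have e2 : -(s + 1) + 1 = -s := by ring
  rw [e1, e2] at hL
  rw [hL]
  field_simp
  ring

/-- The primitive of `psiError`, extended by zero to the left of `1`. -/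
noncomputable def psiErrorPrimitiveExt (x : ℝ) : ℂ := psiErrorPrimitive (max 1 x)

theorem continuous_psiErrorPrimitiveExt : Continuous psiErrorPrimitiveExt :=
  Complex.continuous_ofReal.comp
    (continuous_psiErrorPrimitive.comp (continuous_const.max continuous_id))

theorem psiErrorPrimitiveExt_of_le_one {x : ℝ} (hx : x ≤ 1) : psiErrorPrimitiveExt x = 0 := by
  rw [psiErrorPrimitiveExt, max_eq_left hx, psiErrorPrimitive_one, Complex.ofReal_zero]

theorem psiErrorPrimitiveExt_of_one_le {x : ℝ} (hx : 1 ≤ x) :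
    psiErrorPrimitiveExt x = psiErrorPrimitive x := by
  rw [psiErrorPrimitiveExt, max_eq_right hx]

theorem mellinConvergent_psiErrorPrimitiveExt {z : ℂ} (hz : z.re < -2) :
    MellinConvergent psiErrorPrimitiveExt z := by
  rw [MellinConvergent, ← Ioc_union_Ioi_eq_Ioi zero_le_one, integrableOn_union]
  constructor
  · refine integrableOn_zero.congr_fun (fun t ht => ?_) measurableSet_Ioc
    simp only [psiErrorPrimitiveExt_of_le_one ht.2, smul_zero]
  · refine (integrableOn_psiErrorPrimitive_mul_cpow (w := z - 1) ?_).congr_fun (fun t ht => ?_)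
      measurableSet_Ioi
    · rw [Complex.sub_re, Complex.one_re]; linarith
    · simp only [psiErrorPrimitiveExt_of_one_le (le_of_lt ht), smul_eq_mul]
      ring

theorem mellin_psiErrorPrimitiveExt (z : ℂ) :
    mellin psiErrorPrimitiveExt z =
      ∫ t in Ioi (1 : ℝ), (psiErrorPrimitive t : ℂ) * (t : ℂ) ^ (z - 1) := by
  rw [mellin, setIntegral_eq_of_subset_of_forall_sdiff_eq_zero measurableSet_Ioi
    (Ioi_subset_Ioi zero_le_one)]
  · refine setIntegral_congr_fun measurableSet_Ioi fun t ht => ?_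
    simp only [psiErrorPrimitiveExt_of_one_le (le_of_lt ht), smul_eq_mul]
    ring
  · intro t ht
    rw [psiErrorPrimitiveExt_of_le_one (not_lt.1 ht.2), smul_zero]

theorem deriv_log_riemannZeta₁ {g : ℂ → ℂ} (hg : DifferentiableOn ℂ g {s : ℂ | 1 / 2 < s.re})
    (hexp : ∀ s : ℂ, 1 / 2 < s.re → Complex.exp (g s) = riemannZeta₁ s) {s : ℂ} (hs : 1 < s.re) :
    deriv g s = deriv riemannZeta s / riemannZeta s + 1 / (s - 1) := by
  have hne : s ≠ 1 := fun h => by rw [h] at hs; norm_num at hs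
  have hs1 : s - 1 ≠ 0 := sub_ne_zero.2 hne
  have hζ := riemannZeta_ne_zero_of_one_le_re hs.le
  have hmem : {s : ℂ | 1 / 2 < s.re} ∈ 𝓝 s :=
    (isOpen_re_gt _).mem_nhds (by simp only [mem_ofPred_eq]; linarith)
  have h1 : HasDerivAt (fun s => Complex.exp (g s)) (Complex.exp (g s) * deriv g s) s :=
    (hg.differentiableAt hmem).hasDerivAt.cexp
  have h2 : HasDerivAt (fun s => (s - 1) * riemannZeta s)
      (1 * riemannZeta s + (s - 1) * deriv riemannZeta s) s :=
    ((hasDerivAt_id s).sub_const 1).mul (differentiableAt_riemannZeta hne).hasDerivAt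
  have hE : ∀ᶠ w in 𝓝 s, (w - 1) * riemannZeta w = Complex.exp (g w) := by
    filter_upwards [hmem, isOpen_ne.mem_nhds hne] with w hw hw1
    have hw1 : w - 1 ≠ 0 := sub_ne_zero.2 hw1
    rw [hexp w hw, riemannZeta_eq_inv_sub_mul (sub_ne_zero.1 hw1)]
    field_simp
  have h3 := (h1.congr_of_eventuallyEq hE).unique h2
  rw [← hE.self_of_nhds] at h3
  field_simp
  linear_combination h3

theorem mellin_psiErrorPrimitiveExt_eq {g : ℂ → ℂ}
    (hg : DifferentiableOn ℂ g {s : ℂ | 1 / 2 < s.re})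
    (hexp : ∀ s : ℂ, 1 / 2 < s.re → Complex.exp (g s) = riemannZeta₁ s) {s : ℂ} (hs : s.re = 2) :
    mellin psiErrorPrimitiveExt (-(s + 1)) = -deriv g s * perronKernel s := by
  have hs0 : s ≠ 0 := ne_zero_of_re_pos (by rw [hs]; norm_num)
  have hs1 : s + 1 ≠ 0 := add_one_ne_zero_of_re_pos (by rw [hs]; norm_num)
  have h1 := mul_integral_psiError_mul_cpow hs
  rw [integral_psiError_mul_cpow (by simp [hs]), ← mellin_psiErrorPrimitiveExt] at h1
  rw [deriv_log_riemannZeta₁ hg hexp (by rw [hs]; norm_num), perronKernel]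
  field_simp at h1 ⊢
  linear_combination h1

theorem exists_norm_deriv_log_riemannZeta₁_le {g : ℂ → ℂ}
    (hg : DifferentiableOn ℂ g {s : ℂ | 1 / 2 < s.re})
    (hexp : ∀ s : ℂ, 1 / 2 < s.re → Complex.exp (g s) = riemannZeta₁ s) :
    ∃ C : ℝ, ∀ s : ℂ, s.re = 2 → ‖deriv g s‖ ≤ C := by
  set Λ : ℕ → ℂ := fun n => ((ArithmeticFunction.vonMangoldt n : ℝ) : ℂ) with hΛ
  refine ⟨∑' n, ‖LSeries.term Λ 2 n‖ + 1, fun s hs => ?_⟩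
  have hs1 : 1 < s.re := by rw [hs]; norm_num
  have hsum : Summable fun n => ‖LSeries.term Λ s n‖ :=
    (ArithmeticFunction.LSeriesSummable_vonMangoldt hs1).norm
  have h1 : deriv riemannZeta s / riemannZeta s = -LSeries Λ s := by
    rw [ArithmeticFunction.LSeries_vonMangoldt_eq_deriv_riemannZeta_div hs1]; ring
  have h2 : ∀ n, ‖LSeries.term Λ s n‖ = ‖LSeries.term Λ 2 n‖ := fun n => by
    rw [LSeries.norm_term_eq, LSeries.norm_term_eq, hs]; rfl
  rw [deriv_log_riemannZeta₁ hg hexp hs1, h1]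
  refine (norm_add_le _ _).trans (add_le_add ?_ ?_)
  · rw [norm_neg]
    refine (norm_tsum_le_tsum_norm hsum).trans_eq ?_
    simp_rw [h2]
  · have h3 : 1 ≤ ‖s - 1‖ := by
      have := Complex.abs_re_le_norm (s - 1)
      rw [Complex.sub_re, hs, Complex.one_re] at this
      norm_num at this
      exact this
    rw [norm_div, norm_one]
    exact (div_le_one (by linarith)).2 h3

theorem integral_neg_deriv_mul_perronKernel {g : ℂ → ℂ}
    (hg : DifferentiableOn ℂ g {s : ℂ | 1 / 2 < s.re}) {C C' : ℝ}
    (hline : ∀ t : ℝ, ‖g (2 + t * Complex.I)‖ ≤ C * √(1 + |t|))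
    (hderiv : ∀ s : ℂ, s.re = 2 → ‖deriv g s‖ ≤ C') {u : ℝ} (hu : 0 ≤ u) :
    ∫ t : ℝ, -deriv g ((2 : ℝ) + t * Complex.I) *
        (Complex.exp (u * ((2 : ℝ) + t * Complex.I)) *
          perronKernel ((2 : ℝ) + t * Complex.I)) =
      ∫ t : ℝ, g ((2 : ℝ) + t * Complex.I) * perronWeight u ((2 : ℝ) + t * Complex.I) := by
  set S : Set ℂ := {s : ℂ | 1 / 2 < s.re} with hS
  have hmem : ∀ t : ℝ, ((2 : ℝ) + t * Complex.I : ℂ) ∈ S := fun t => by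
    simp only [hS, mem_ofPred_eq, re_ofReal_add_mul_I]; norm_num
  have hpos : ∀ s ∈ S, 0 < s.re := fun s hs => by
    have : 1 / 2 < s.re := hs
    linarith
  have hSo : IsOpen S := isOpen_re_gt _
  have hC : 0 ≤ C := by
    have := (norm_nonneg _).trans (hline 0)
    simpa using this
  have hC' : 0 ≤ C' := (norm_nonneg _).trans (hderiv 2 (by simp))
  have hline' : ∀ t : ℝ, ‖g ((2 : ℝ) + t * Complex.I)‖ ≤ C * √(1 + |t|) := fun t => by
    rw [Complex.ofReal_ofNat]; exact hline t
  set K : ℂ → ℂ := fun s => Complex.exp (u * s) * perronKernel s with hK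
  have hKd : ∀ s ∈ S, HasDerivAt K (perronWeight u s) s := fun s hs =>
    hasDerivAt_exp_mul_perronKernel u (hpos s hs)
  have hKb : ∀ t : ℝ, ‖K ((2 : ℝ) + t * Complex.I)‖ ≤
      Real.exp (u * 2) * 25 * (1 + |t|) ^ (-2 : ℝ) := fun t => by
    have h := norm_perronKernel_le (s := ((2 : ℝ) + t * Complex.I : ℂ))
      (by rw [re_ofReal_add_mul_I]; norm_num)
    rw [im_ofReal_add_mul_I] at h
    rw [hK, norm_mul, Complex.norm_exp, Complex.re_ofReal_mul, re_ofReal_add_mul_I, mul_assoc]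
    exact mul_le_mul_of_nonneg_left h (Real.exp_pos _).le
  have hKc : ContinuousOn K S := fun s hs => (hKd s hs).continuousAt.continuousWithinAt
  have hWc : ContinuousOn (perronWeight u) S := fun s hs =>
    (differentiableAt_perronWeight u (hpos s hs)).continuousAt.continuousWithinAt
  have hint1 : Integrable fun t : ℝ => (fun s => deriv g s * K s) ((2 : ℝ) + t * Complex.I) := by
    refine integrable_vertical (S := S) (C := C' * (Real.exp (u * 2) * 25)) (r := 2)
      ((hg.deriv hSo).continuousOn.mul hKc) one_lt_two hmem fun t => ?_
    rw [Pi.mul_apply, norm_mul, mul_assoc]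
    exact mul_le_mul (hderiv _ (re_ofReal_add_mul_I _ _)) (hKb t) (norm_nonneg _) hC'
  have hint2 : Integrable fun t : ℝ =>
      (fun s => g s * perronWeight u s) ((2 : ℝ) + t * Complex.I) := by
    refine integrable_vertical (S := S) (C := C * (125 * (Real.exp (u * 2) * (u + 1))))
      (r := 3 / 2) (hg.continuousOn.mul hWc) (by norm_num) hmem fun t => ?_
    have h := norm_mul_perronWeight_le (s := ((2 : ℝ) + t * Complex.I : ℂ)) hu
      (by rw [re_ofReal_add_mul_I]; norm_num) hC (y := g ((2 : ℝ) + t * Complex.I))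
      (by rw [im_ofReal_add_mul_I]; exact hline' t)
    rwa [im_ofReal_add_mul_I, re_ofReal_add_mul_I] at h
  have hint3 : Integrable fun t : ℝ => (fun s => g s * K s) ((2 : ℝ) + t * Complex.I) := by
    refine integrable_vertical (S := S) (C := C * (Real.exp (u * 2) * 25)) (r := 3 / 2)
      (hg.continuousOn.mul hKc) (by norm_num) hmem fun t => ?_
    rw [Pi.mul_apply, norm_mul, ← sqrt_mul_rpow_neg_two (by positivity)]
    calc _ ≤ (C * √(1 + |t|)) * (Real.exp (u * 2) * 25 * (1 + |t|) ^ (-2 : ℝ)) :=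
          mul_le_mul (hline' t) (hKb t) (norm_nonneg _) (by positivity)
      _ = _ := by ring
  have hd : ∀ t : ℝ, HasDerivAt (fun t : ℝ => (fun s => g s * K s) ((2 : ℝ) + t * Complex.I))
      (((fun s => deriv g s * K s) ((2 : ℝ) + t * Complex.I) +
        (fun s => g s * perronWeight u s) ((2 : ℝ) + t * Complex.I)) * Complex.I) t := fun t =>
    (((hg.differentiableAt (hSo.mem_nhds (hmem t))).hasDerivAt.mul (hKd _ (hmem t))).comp_of_eq t
      (hasDerivAt_add_mul_I 2 t) rfl)
  have hzero := integral_eq_zero_of_hasDerivAt_of_integrable hd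
    ((hint1.add hint2).mul_const Complex.I) hint3
  rw [integral_mul_const, mul_eq_zero, or_iff_left Complex.I_ne_zero,
    integral_add hint1 hint2] at hzero
  simp only [neg_mul]
  rw [integral_neg]
  linear_combination -hzero

theorem psiErrorPrimitive_eq_integral {g : ℂ → ℂ}
    (hg : DifferentiableOn ℂ g {s : ℂ | 1 / 2 < s.re})
    (hexp : ∀ s : ℂ, 1 / 2 < s.re → Complex.exp (g s) = riemannZeta₁ s) {C : ℝ}
    (hline : ∀ t : ℝ, ‖g (2 + t * Complex.I)‖ ≤ C * √(1 + |t|)) {x : ℝ} (hx : 1 ≤ x) :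
    (psiErrorPrimitive x : ℂ) = x / (2 * Real.pi) *
      ∫ t : ℝ, g ((2 : ℝ) + t * Complex.I) *
        perronWeight (Real.log x) ((2 : ℝ) + t * Complex.I) := by
  obtain ⟨C', hC'⟩ := exists_norm_deriv_log_riemannZeta₁_le hg hexp
  have hC'0 : 0 ≤ C' := (norm_nonneg _).trans (hC' 2 (by simp))
  have hx0 : 0 < x := one_pos.trans_le hx
  have hxc : (x : ℂ) ≠ 0 := Complex.ofReal_ne_zero.2 hx0.ne'
  have hmell : ∀ t : ℝ, mellin psiErrorPrimitiveExt (((-3 : ℝ) : ℂ) + ((-t : ℝ) : ℂ) * Complex.I) =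
      -deriv g ((2 : ℝ) + t * Complex.I) * perronKernel ((2 : ℝ) + t * Complex.I) := fun t => by
    rw [← mellin_psiErrorPrimitiveExt_eq hg hexp (re_ofReal_add_mul_I _ _)]
    congr 1
    push_cast
    ring
  have hvert : Complex.VerticalIntegrable (mellin psiErrorPrimitiveExt) (-3) := by
    have h : Integrable fun t : ℝ =>
        (fun s => -deriv g s * perronKernel s) ((2 : ℝ) + t * Complex.I) := by
      refine integrable_vertical (S := {s : ℂ | 1 / 2 < s.re}) (C := C' * 25) (r := 2)
        ((hg.deriv (isOpen_re_gt _)).continuousOn.neg.mul fun s hs => ?_) one_lt_two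
        (fun t => ?_) fun t => ?_
      · have hs : 1 / 2 < s.re := hs
        exact (hasDerivAt_perronKernel (by linarith)).continuousAt.continuousWithinAt
      · simp only [mem_ofPred_eq, re_ofReal_add_mul_I]; norm_num
      · have h := norm_perronKernel_le (s := ((2 : ℝ) + t * Complex.I : ℂ))
          (by rw [re_ofReal_add_mul_I]; norm_num)
        rw [im_ofReal_add_mul_I] at h
        rw [Pi.mul_apply, norm_mul, Pi.neg_apply, norm_neg, mul_assoc]
        exact mul_le_mul (hC' _ (re_ofReal_add_mul_I _ _)) h (norm_nonneg _) hC'0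
    refine h.comp_neg.congr (Eventually.of_forall fun t => ?_)
    have := hmell (-t)
    rw [neg_neg] at this
    exact this.symm
  have hinv := mellinInv_mellin_eq (-3) psiErrorPrimitiveExt hx0
    (mellinConvergent_psiErrorPrimitiveExt (by rw [Complex.ofReal_re]; norm_num)) hvert
    continuous_psiErrorPrimitiveExt.continuousAt
  rw [psiErrorPrimitiveExt_of_one_le hx, mellinInv, ← integral_neg_eq_self] at hinv
  rw [← integral_neg_deriv_mul_perronKernel hg hline hC' (Real.log_nonneg hx), ← hinv,
    Complex.real_smul, ← integral_const_mul, ← integral_const_mul]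
  refine integral_congr_ae (Eventually.of_forall fun t => ?_)
  have h := hmell t
  push_cast at h ⊢
  simp only [smul_eq_mul]
  rw [h, Complex.cpow_def_of_ne_zero hxc, ← Complex.ofReal_log hx0.le]
  have he : (Real.log x : ℂ) * -(-3 + -(t : ℂ) * Complex.I) =
      Real.log x + Real.log x * (2 + t * Complex.I) := by ring
  rw [he, Complex.exp_add, ← Complex.ofReal_exp, Real.exp_log hx0]
  ring

theorem eventually_abs_psiErrorPrimitive_le
    (h : ∀ ρ : ℂ, riemannZeta ρ = 0 → 0 < ρ.re → ρ.re < 1 → ρ.re = 1 / 2) {ε : ℝ} (hε : 0 < ε) :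
    ∀ᶠ x : ℝ in atTop, |psiErrorPrimitive x| ≤ ε * (x * √x * Real.log x) := by
  obtain ⟨g, hg, hexp⟩ := exists_log_on_re_gt_half differentiable_riemannZeta₁
    (fun s hs => riemannZeta₁_ne_zero_of_RH h hs)
  obtain ⟨C, hC⟩ := exists_norm_log_riemannZeta₁_le hg hexp
  have hJ := eventually_norm_integral_mul_perronWeight_le hg
    (fun s hs => re_log_riemannZeta₁_le hexp hs) hC differentiable_riemannZeta₁ hexp hε
  filter_upwards [Real.tendsto_log_atTop.eventually hJ, eventually_ge_atTop 1] with x hx hx1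
  have hx0 : 0 < x := one_pos.trans_le hx1
  have hsqrt : Real.exp (Real.log x / 2) = √x := by
    rw [← Real.log_sqrt hx0.le, Real.exp_log (Real.sqrt_pos.2 hx0)]
  rw [hsqrt] at hx
  have hE := congrArg norm (psiErrorPrimitive_eq_integral hg hexp hC hx1)
  rw [Complex.norm_real, Real.norm_eq_abs, norm_mul] at hE
  have hpi : ‖(x / (2 * Real.pi) : ℂ)‖ ≤ x := by
    have : (x / (2 * Real.pi) : ℂ) = ((x / (2 * Real.pi) : ℝ) : ℂ) := by push_cast; ring
    rw [this, Complex.norm_real, Real.norm_eq_abs, abs_of_nonneg (by positivity)]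
    exact div_le_self hx0.le (by linarith [Real.pi_gt_three])
  rw [hE]
  calc _ ≤ x * (ε * (Real.log x * √x)) := mul_le_mul hpi hx (norm_nonneg _) hx0.le
    _ = _ := by ring

theorem psiErrorPrimitive_sub (a b : ℝ) :
    psiErrorPrimitive b - psiErrorPrimitive a = ∫ t in a..b, psiError t :=
  intervalIntegral.integral_interval_sub_left (intervalIntegrable_psiError _ _)
    (intervalIntegrable_psiError _ _)

theorem integral_sub_one (a b : ℝ) : ∫ t in a..b, (t - 1) = (b ^ 2 - a ^ 2) / 2 - (b - a) := by
  rw [intervalIntegral.integral_sub (continuous_id'.intervalIntegrable _ _) (by simp)]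
  simp

theorem mul_psiError_le {x h : ℝ} (hh : 0 ≤ h) :
    h * psiError x ≤ psiErrorPrimitive (x + h) - psiErrorPrimitive x + h ^ 2 / 2 := by
  have h1 : ∫ t in x..x + h, (Chebyshev.psi x - (t - 1)) ≤ ∫ t in x..x + h, psiError t := by
    refine intervalIntegral.integral_mono_on (by linarith) ?_ (intervalIntegrable_psiError _ _)
      fun t ht => ?_
    · exact (by fun_prop : Continuous fun t : ℝ => Chebyshev.psi x - (t - 1)).intervalIntegrable _ _
    · exact sub_le_sub_right (Chebyshev.psi_mono ht.1) _
  rw [intervalIntegral.integral_sub (by simp) (by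
    exact (by fun_prop : Continuous fun t : ℝ => t - 1).intervalIntegrable _ _),
    integral_sub_one, ← psiErrorPrimitive_sub] at h1
  simp only [intervalIntegral.integral_const, smul_eq_mul] at h1
  rw [psiError]
  linarith

theorem le_mul_psiError {x h : ℝ} (hh : 0 ≤ h) :
    psiErrorPrimitive x - psiErrorPrimitive (x - h) - h ^ 2 / 2 ≤ h * psiError x := by
  have h1 : ∫ t in (x - h)..x, psiError t ≤ ∫ t in (x - h)..x, (Chebyshev.psi x - (t - 1)) := by
    refine intervalIntegral.integral_mono_on (by linarith) (intervalIntegrable_psiError _ _) ?_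
      fun t ht => ?_
    · exact (by fun_prop : Continuous fun t : ℝ => Chebyshev.psi x - (t - 1)).intervalIntegrable _ _
    · exact sub_le_sub_right (Chebyshev.psi_mono ht.2) _
  rw [intervalIntegral.integral_sub (by simp) (by
    exact (by fun_prop : Continuous fun t : ℝ => t - 1).intervalIntegrable _ _),
    integral_sub_one, ← psiErrorPrimitive_sub] at h1
  simp only [intervalIntegral.integral_const, smul_eq_mul] at h1
  rw [psiError]
  linarith

theorem eventually_log_le_mul_sqrt {c : ℝ} (hc : 0 < c) :
    ∀ᶠ x : ℝ in atTop, Real.log x ≤ c * √x := by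
  have h := (isLittleO_log_rpow_atTop (r := 1 / 2) (by norm_num)).bound hc
  filter_upwards [h, eventually_ge_atTop 1] with x hx hx1
  rw [Real.norm_eq_abs, Real.norm_eq_abs, abs_of_nonneg (Real.log_nonneg hx1),
    abs_of_nonneg (by positivity), ← Real.sqrt_eq_rpow] at hx
  exact hx

theorem eventually_psiError_sq_le
    (hP : ∀ ε : ℝ, 0 < ε →
      ∀ᶠ x : ℝ in atTop, |psiErrorPrimitive x| ≤ ε * (x * √x * Real.log x)) {ε : ℝ} (hε : 0 < ε) :
    ∀ᶠ x : ℝ in atTop, psiError x ^ 2 ≤ ε * (x * √x * Real.log x) := by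
  obtain ⟨δ, hδ, rfl⟩ : ∃ δ : ℝ, 0 < δ ∧ 200 * δ = ε := ⟨ε / 200, by positivity, by ring⟩
  obtain ⟨X, hX⟩ := eventually_atTop.1 (hP δ hδ)
  filter_upwards [eventually_ge_atTop (2 * X), eventually_ge_atTop 2,
    eventually_log_le_mul_sqrt (c := 1 / (4 * δ)) (by positivity)] with x hxX hx2 hlog
  have hx0 : 0 < x := by linarith
  have hsx : √x * √x = x := Real.mul_self_sqrt hx0.le
  have hsx0 : 0 < √x := Real.sqrt_pos.2 hx0
  have hL : 0 < Real.log x := Real.log_pos (by linarith)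
  set A : ℝ := x * √x * Real.log x with hA
  have hA0 : 0 < A := by positivity
  set h : ℝ := √(δ * A) with hh
  have hh0 : 0 < h := Real.sqrt_pos.2 (by positivity)
  have hh2 : h ^ 2 = δ * A := Real.sq_sqrt (by positivity)
  have hhx : h ≤ x / 2 := by
    refine abs_le_of_sq_le_sq' ?_ (by positivity) |>.2
    rw [hh2, hA]
    have h1 : δ * Real.log x ≤ √x / 4 := by
      calc δ * Real.log x ≤ δ * (1 / (4 * δ) * √x) := by gcongr
        _ = _ := by field_simp
    calc δ * (x * √x * Real.log x) = x * √x * (δ * Real.log x) := by ring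
      _ ≤ x * √x * (√x / 4) := by gcongr
      _ = (x / 2) ^ 2 := by linear_combination (x / 4) * hsx
  have hbound : ∀ y, x / 2 ≤ y → y ≤ 2 * x → |psiErrorPrimitive y| ≤ 6 * h ^ 2 := by
    intro y hy1 hy2
    refine (hX y (by linarith)).trans ?_
    have hy0 : 0 < y := by linarith
    have h1 : √y ≤ 3 / 2 * √x := by
      rw [show (3 / 2 : ℝ) = √(9 / 4) by
        rw [show (9 / 4 : ℝ) = (3 / 2) ^ 2 by norm_num, Real.sqrt_sq (by norm_num)],
        ← Real.sqrt_mul (by norm_num)]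
      exact Real.sqrt_le_sqrt (by linarith)
    have h2 : Real.log y ≤ 2 * Real.log x := by
      rw [← Real.log_rpow hx0, Real.rpow_two]
      exact Real.log_le_log hy0 (by nlinarith)
    have h3 : y * √y ≤ (2 * x) * (3 / 2 * √x) := by gcongr
    rw [hh2, hA]
    calc δ * (y * √y * Real.log y) ≤ δ * ((2 * x) * (3 / 2 * √x) * (2 * Real.log x)) := by
          have h4 : y * √y * Real.log y ≤ y * √y * (2 * Real.log x) := by gcongr
          gcongr δ * ?_
          exact h4.trans (by gcongr)
      _ = _ := by ring
  have b1 := abs_le.1 (hbound x (by linarith) (by linarith))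
  have b2 := abs_le.1 (hbound (x + h) (by linarith) (by linarith))
  have b3 := abs_le.1 (hbound (x - h) (by linarith) (by linarith))
  have u := mul_psiError_le (x := x) hh0.le
  have l := le_mul_psiError (x := x) hh0.le
  have u' : psiError x ≤ 25 / 2 * h := by
    refine le_of_mul_le_mul_left ?_ hh0
    nlinarith
  have l' : -(25 / 2 * h) ≤ psiError x := by
    refine le_of_mul_le_mul_left ?_ hh0
    nlinarith
  have := sq_le_sq' l' u'
  rw [mul_pow, hh2] at this
  have hδA : 0 < δ * A := by positivity
  nlinarith

theorem intervalIntegrable_one_div_log {a b : ℝ} (ha : 1 < a) (hb : 1 < b) :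
    IntervalIntegrable (fun t => 1 / Real.log t) volume a b := by
  refine ContinuousOn.intervalIntegrable fun t ht => ?_
  have ht1 : 1 < t := (lt_min ha hb).trans_le ht.1
  exact (continuousAt_const.div (Real.continuousAt_log (by linarith))
    (Real.log_pos ht1).ne').continuousWithinAt

theorem Li_sub {a b : ℝ} (ha : 1 < a) (hb : 1 < b) :
    Li b - Li a = ∫ t in a..b, 1 / Real.log t :=
  intervalIntegral.integral_interval_sub_left (intervalIntegrable_one_div_log one_lt_two hb)
    (intervalIntegrable_one_div_log one_lt_two ha)

theorem Li_mono {a b : ℝ} (ha : 1 < a) (hab : a ≤ b) : Li a ≤ Li b := by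
  rw [← sub_nonneg, Li_sub ha (ha.trans_le hab)]
  refine intervalIntegral.integral_nonneg hab fun t ht => ?_
  exact one_div_nonneg.2 (Real.log_nonneg (ha.le.trans ht.1))

theorem abs_log_sub_log_le {a x y : ℝ} (ha : 0 < a) (hx : a ≤ x) (hy : a ≤ y) :
    |Real.log x - Real.log y| ≤ |x - y| / a := by
  have key : ∀ u v : ℝ, a ≤ u → u ≤ v → Real.log v - Real.log u ≤ (v - u) / a := by
    intro u v hu huv
    have hu0 : 0 < u := ha.trans_le hu
    rw [← Real.log_div (by linarith) hu0.ne']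
    refine (Real.log_le_sub_one_of_pos (div_pos (by linarith) hu0)).trans ?_
    rw [div_sub_one hu0.ne']
    exact div_le_div_of_nonneg_left (by linarith) ha hu
  rcases le_total x y with h | h
  · rw [abs_sub_comm, abs_sub_comm x, abs_of_nonneg (sub_nonneg.2 h), abs_of_nonneg]
    · exact key x y hx h
    · exact sub_nonneg.2 (Real.log_le_log (ha.trans_le hx) h)
  · rw [abs_of_nonneg (sub_nonneg.2 h), abs_of_nonneg]
    · exact key y x hy h
    · exact sub_nonneg.2 (Real.log_le_log (ha.trans_le hy) h)

theorem abs_Li_sub_sub_div_log_le {a x y : ℝ} (ha : 1 < a) (hx : a ≤ x) (hy : a ≤ y) :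
    |Li y - Li x - (y - x) / Real.log x| ≤ (y - x) ^ 2 / (a * Real.log a ^ 2) := by
  have hx1 : 1 < x := ha.trans_le hx
  have hy1 : 1 < y := ha.trans_le hy
  have hLa : 0 < Real.log a := Real.log_pos ha
  have ha0 : 0 < a := by linarith
  have h1 : (y - x) / Real.log x = ∫ _t in x..y, 1 / Real.log x := by
    rw [intervalIntegral.integral_const, smul_eq_mul]; ring
  rw [Li_sub hx1 hy1, h1, ← intervalIntegral.integral_sub
    (intervalIntegrable_one_div_log hx1 hy1) (by simp)]
  have h2 := intervalIntegral.norm_integral_le_of_norm_le_const (a := x) (b := y)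
    (f := fun t => 1 / Real.log t - 1 / Real.log x) (C := |y - x| / (a * Real.log a ^ 2)) (by
      intro t ht
      have ht' : min x y < t ∧ t ≤ max x y := ht
      have hat : a ≤ t := (le_min hx hy).trans ht'.1.le
      have htx : |x - t| ≤ |y - x| := by
        rw [abs_sub_comm x, abs_sub_comm y]
        rcases le_total x y with h | h
        · rw [min_eq_left h, max_eq_right h] at ht'
          rw [abs_of_nonneg (by linarith), abs_of_nonpos (by linarith)]; linarith
        · rw [min_eq_right h, max_eq_left h] at ht'
          rw [abs_of_nonpos (by linarith), abs_of_nonneg (by linarith)]; linarith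
      have hLt : Real.log a ≤ Real.log t := Real.log_le_log ha0 hat
      have hLx : Real.log a ≤ Real.log x := Real.log_le_log ha0 hx
      rw [div_sub_div _ _ (by linarith) (by linarith), Real.norm_eq_abs, abs_div, one_mul, mul_one,
        abs_of_pos (mul_pos (hLa.trans_le hLt) (hLa.trans_le hLx)), ← div_div |y - x|]
      refine div_le_div₀ (by positivity) ((abs_log_sub_log_le ha0 hx hat).trans ?_)
        (by positivity) ?_
      · gcongr
      · rw [sq]
        exact mul_le_mul hLt hLx hLa.le (hLa.le.trans hLt))
  rw [Real.norm_eq_abs] at h2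
  refine h2.trans_eq ?_
  rw [div_mul_eq_mul_div, ← sq, sq_abs]

theorem hasDerivAt_div_log {t : ℝ} (ht : 1 < t) :
    HasDerivAt (fun t => t / Real.log t) (1 / Real.log t - 1 / Real.log t ^ 2) t := by
  have hL : Real.log t ≠ 0 := (Real.log_pos ht).ne'
  have ht0 : t ≠ 0 := by linarith
  convert! (hasDerivAt_id t).div (Real.hasDerivAt_log ht0) hL using 1
  simp only [id]
  field_simp

theorem Li_eq {x : ℝ} (hx : 2 ≤ x) :
    Li x = x / Real.log x - 2 / Real.log 2 + ∫ t in (2 : ℝ)..x, 1 / Real.log t ^ 2 := by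
  have hx1 : 1 < x := by linarith
  have h1 := intervalIntegrable_one_div_log one_lt_two hx1
  have h2 := Chebyshev.intervalIntegrable_one_div_log_sq one_lt_two hx1
  have h := intervalIntegral.integral_eq_sub_of_hasDerivAt (a := 2) (b := x)
    (f := fun t => t / Real.log t) (fun t ht => hasDerivAt_div_log (by
      rw [uIcc_of_le hx] at ht; linarith [ht.1])) (h1.sub h2)
  rw [intervalIntegral.integral_sub h1 h2] at h
  rw [Li]
  linarith

theorem intervalIntegrable_psiError_div {a b : ℝ} (ha : 1 < a) (hb : 1 < b) :
    IntervalIntegrable (fun t => psiError t * (1 / (t * Real.log t ^ 2))) volume a b := by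
  refine (intervalIntegrable_psiError a b).mul_continuousOn fun t ht => ?_
  have ht1 : 1 < t := (lt_min ha hb).trans_le ht.1
  have hne : t * Real.log t ^ 2 ≠ 0 :=
    mul_ne_zero (by linarith) (pow_ne_zero _ (Real.log_pos ht1).ne')
  exact (continuousAt_const.div
    (continuousAt_id.mul ((Real.continuousAt_log (by linarith)).pow 2)) hne).continuousWithinAt

theorem le_Li_add_sub_primeCounting {x : ℝ} (hx : 2 ≤ x) :
    (Chebyshev.psi x - Chebyshev.theta x) / Real.log x - 2 / Real.log 2 -
        ∫ t in (2 : ℝ)..x, psiError t * (1 / (t * Real.log t ^ 2)) ≤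
      Li x + (Chebyshev.psi x - x) / Real.log x - Nat.primeCounting ⌊x⌋₊ := by
  have hx1 : 1 < x := by linarith
  have hi1 := Chebyshev.intervalIntegrable_one_div_log_sq one_lt_two hx1
  have hi2 : IntervalIntegrable (fun t => Chebyshev.theta t / (t * Real.log t ^ 2)) volume 2 x :=
    (intervalIntegrable_iff_integrableOn_Icc_of_le hx).2
      (Chebyshev.integrableOn_theta_div_id_mul_log_sq x)
  have h : ∫ t in (2 : ℝ)..x, -(psiError t * (1 / (t * Real.log t ^ 2))) ≤
      ∫ t in (2 : ℝ)..x, (1 / Real.log t ^ 2 - Chebyshev.theta t / (t * Real.log t ^ 2)) := by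
    refine intervalIntegral.integral_mono_on hx
      (intervalIntegrable_psiError_div one_lt_two hx1).neg (hi1.sub hi2) fun t ht => ?_
    have ht0 : 0 < t := by linarith [ht.1]
    have hL : 0 < Real.log t := Real.log_pos (by linarith [ht.1])
    have e : 1 / Real.log t ^ 2 - Chebyshev.theta t / (t * Real.log t ^ 2) =
        (t - Chebyshev.theta t) * (1 / (t * Real.log t ^ 2)) := by field_simp
    rw [e, ← neg_mul, psiError]
    refine mul_le_mul_of_nonneg_right ?_ (by positivity)
    linarith [Chebyshev.theta_le_psi t]
  rw [intervalIntegral.integral_neg, intervalIntegral.integral_sub hi1 hi2] at h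
  rw [Li_eq hx, Chebyshev.primeCounting_eq_theta_div_log_add_integral hx, sub_div, sub_div]
  linarith

theorem eventually_sqrt_div_two_le_psi_sub_theta :
    ∀ᶠ x : ℝ in atTop, √x / 2 ≤ Chebyshev.psi x - Chebyshev.theta x := by
  have hsqrt : Tendsto (fun x : ℝ => √x) atTop atTop := Real.tendsto_sqrt_atTop
  filter_upwards [hsqrt.eventually (eventually_log_le_mul_sqrt (c := 1 / 100) (by norm_num)),
    hsqrt.eventually (eventually_ge_atTop 100), eventually_ge_atTop 0] with x hlog hx hx0
  have h1 := Chebyshev.psi_sub_theta_ge_psi_add_psi_add_psi hx0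
  have h2 := Chebyshev.psi_nonneg (x ^ (3 : ℝ)⁻¹)
  have h3 := Chebyshev.psi_nonneg (x ^ (7 : ℝ)⁻¹)
  have h4 := Chebyshev.psi_ge' (Real.sqrt_nonneg x)
  have h5 : x ^ (2 : ℝ)⁻¹ = √x := by rw [Real.sqrt_eq_rpow, one_div]
  rw [h5] at h1
  have h6 : Real.log (√x + 2) ≤ Real.log (√x) + 1 := by
    have h7 := Real.log_le_sub_one_of_pos (x := (√x + 2) / √x) (by positivity)
    rw [Real.log_div (by positivity) (by positivity), div_sub_one (by positivity)] at h7
    have h8 : (√x + 2 - √x) / √x ≤ 1 := (div_le_one (by positivity)).2 (by linarith)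
    linarith
  have h9 : √(√x) ≤ √x := Real.sqrt_le_iff.2 ⟨by positivity, by nlinarith⟩
  have h10 := Real.log_two_gt_d9
  nlinarith

theorem hasDerivAt_one_div_mul_log_sq {t : ℝ} (ht : 1 < t) :
    HasDerivAt (fun t => 1 / (t * Real.log t ^ 2))
      (-((Real.log t + 2) / (t ^ 2 * Real.log t ^ 3))) t := by
  have hL : Real.log t ≠ 0 := (Real.log_pos ht).ne'
  have ht0 : t ≠ 0 := by linarith
  have h := ((hasDerivAt_id t).mul ((Real.hasDerivAt_log ht0).pow 2)).inv
    (mul_ne_zero ht0 (pow_ne_zero 2 hL))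
  have e : (fun t => 1 / (t * Real.log t ^ 2)) = (id * Real.log ^ 2)⁻¹ := by
    ext; simp
  rw [e]
  convert! h using 1
  simp only [id, Pi.mul_apply, Pi.pow_apply]
  field_simp
  push_cast
  ring

theorem hasDerivAt_sqrt_div_log {t : ℝ} (ht : 1 < t) :
    HasDerivAt (fun t => √t / Real.log t)
      ((Real.log t - 2) / (2 * √t * Real.log t ^ 2)) t := by
  have hL : Real.log t ≠ 0 := (Real.log_pos ht).ne'
  have ht0 : 0 < t := by linarith
  have hs : √t * √t = t := Real.mul_self_sqrt ht0.le
  have hs0 : √t ≠ 0 := (Real.sqrt_pos.2 ht0).ne'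
  convert! (Real.hasDerivAt_sqrt ht0.ne').div (Real.hasDerivAt_log ht0.ne') hL using 1
  rw [← hs, Real.sqrt_mul_self (Real.sqrt_nonneg _), hs]
  field_simp
  linear_combination 2 * Real.sq_sqrt ht0.le

theorem integral_psiError_div_le {ε X x : ℝ} (hε : 0 ≤ ε) (hX : Real.exp 4 ≤ X) (hx : X ≤ x)
    (hP : ∀ y, X ≤ y → |psiErrorPrimitive y| ≤ ε * (y * √y * Real.log y)) :
    ∫ t in X..x, psiError t * (1 / (t * Real.log t ^ 2)) ≤
      9 * ε * (√x / Real.log x) + |psiErrorPrimitive X| := by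
  have hexp4 : 5 ≤ Real.exp 4 := by
    have := Real.add_one_le_exp (4 : ℝ)
    linarith
  have hlog : ∀ t, X ≤ t → 4 ≤ Real.log t := fun t ht =>
    (Real.le_log_iff_exp_le (by linarith)).2 (hX.trans ht)
  have hcont : ContinuousOn (fun t : ℝ => -((Real.log t + 2) / (t ^ 2 * Real.log t ^ 3)))
      (Icc X x) := fun t ht => by
    have h1 := hlog t ht.1
    have ht0 : t ≠ 0 := by linarith [ht.1]
    have hne : t ^ 2 * Real.log t ^ 3 ≠ 0 := by positivity
    have hlc := Real.continuousAt_log ht0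
    exact ((hlc.add continuousAt_const).div
      ((continuousAt_id.pow 2).mul (hlc.pow 3)) hne).neg.continuousWithinAt
  rw [integral_psiError_mul (by linarith) hx
    (fun t ht => hasDerivAt_one_div_mul_log_sq (by linarith [ht.1])) hcont]
  have hcont' : ContinuousOn (fun t : ℝ => (Real.log t - 2) / (2 * √t * Real.log t ^ 2))
      (Icc X x) := fun t ht => by
    have h1 := hlog t ht.1
    have ht0 : 0 < t := by linarith [ht.1]
    have hne : 2 * √t * Real.log t ^ 2 ≠ 0 := by positivity
    have hlc := Real.continuousAt_log ht0.ne'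
    exact ((hlc.sub continuousAt_const).div
      ((continuousAt_const.mul Real.continuous_sqrt.continuousAt).mul
        (hlc.pow 2)) hne).continuousWithinAt
  have hFTC := intervalIntegral.integral_eq_sub_of_hasDerivAt (a := X) (b := x)
    (f := fun t => √t / Real.log t)
    (fun t ht => hasDerivAt_sqrt_div_log (by rw [uIcc_of_le hx] at ht; linarith [ht.1]))
    (ContinuousOn.intervalIntegrable (by rwa [uIcc_of_le hx]))
  have hmono : ∫ t in X..x, -(8 * ε * ((Real.log t - 2) / (2 * √t * Real.log t ^ 2))) ≤
      ∫ t in X..x, psiErrorPrimitive t * -((Real.log t + 2) / (t ^ 2 * Real.log t ^ 3)) := by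
    refine intervalIntegral.integral_mono_on hx ?_ ?_ fun t ht => ?_
    · exact (ContinuousOn.intervalIntegrable (by
        rw [uIcc_of_le hx]; exact (continuousOn_const.mul hcont').neg))
    · exact (ContinuousOn.intervalIntegrable (by
        rw [uIcc_of_le hx]; exact continuous_psiErrorPrimitive.continuousOn.mul hcont))
    · have hL := hlog t ht.1
      have ht0 : 0 < t := by linarith [ht.1]
      have hs0 : 0 < √t := Real.sqrt_pos.2 ht0
      rw [mul_neg, neg_le_neg_iff]
      refine (mul_le_mul_of_nonneg_right ((le_abs_self _).trans (hP t ht.1))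
        (by positivity)).trans ?_
      have e1 : ε * (t * √t * Real.log t) * ((Real.log t + 2) / (t ^ 2 * Real.log t ^ 3)) =
          ε * ((Real.log t + 2) / (√t * Real.log t ^ 2)) := by
        field_simp
        rw [Real.sq_sqrt ht0.le]
      have e2 : 8 * ε * ((Real.log t - 2) / (2 * √t * Real.log t ^ 2)) =
          ε * ((4 * (Real.log t - 2)) / (√t * Real.log t ^ 2)) := by
        field_simp
        ring
      rw [e1, e2]
      gcongr
      linarith
  rw [intervalIntegral.integral_neg, intervalIntegral.integral_const_mul, hFTC] at hmono
  have hX0 : 0 ≤ 8 * ε * (√X / Real.log X) := by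
    have := hlog X le_rfl
    positivity
  have hend : psiErrorPrimitive x * (1 / (x * Real.log x ^ 2)) ≤ ε * (√x / Real.log x) := by
    have hL := hlog x hx
    have hx0 : 0 < x := by linarith
    refine (mul_le_mul_of_nonneg_right ((le_abs_self _).trans (hP x hx)) (by positivity)).trans_eq ?_
    field_simp
  have hstart : -(psiErrorPrimitive X * (1 / (X * Real.log X ^ 2))) ≤ |psiErrorPrimitive X| := by
    have hL := hlog X le_rfl
    have hX0 : 1 ≤ X := by linarith
    rw [← neg_mul]
    refine (mul_le_mul_of_nonneg_right (neg_le_abs _) (by positivity)).trans ?_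
    refine mul_le_of_le_one_right (abs_nonneg _) ((div_le_one (by positivity)).2 ?_)
    nlinarith
  linarith

theorem tendsto_sqrt_div_log_atTop : Tendsto (fun x : ℝ => √x / Real.log x) atTop atTop := by
  refine tendsto_atTop.2 fun b => ?_
  filter_upwards [eventually_log_le_mul_sqrt (c := 1 / (|b| + 1)) (by positivity),
    eventually_gt_atTop 1] with x hx hx1
  have hL : 0 < Real.log x := Real.log_pos hx1
  rw [one_div_mul_eq_div, le_div_iff₀ (by positivity)] at hx
  refine (le_abs_self b).trans ((le_div_iff₀ hL).2 ?_)
  nlinarith [abs_nonneg b]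

theorem eventually_integral_psiError_div_le
    (hP : ∀ ε : ℝ, 0 < ε →
      ∀ᶠ x : ℝ in atTop, |psiErrorPrimitive x| ≤ ε * (x * √x * Real.log x)) {ε : ℝ} (hε : 0 < ε) :
    ∀ᶠ x : ℝ in atTop, ∫ t in (2 : ℝ)..x, psiError t * (1 / (t * Real.log t ^ 2)) ≤
      ε * (√x / Real.log x) := by
  obtain ⟨δ, hδ, rfl⟩ : ∃ δ : ℝ, 0 < δ ∧ 10 * δ = ε := ⟨ε / 10, by positivity, by ring⟩
  obtain ⟨X₀, hX₀⟩ := eventually_atTop.1 (hP δ hδ)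
  set X := max X₀ (Real.exp 4) with hX
  have hX1 : 1 < X := (Real.one_lt_exp_iff.2 (by norm_num)).trans_le (le_max_right _ _)
  filter_upwards [eventually_ge_atTop X, (tendsto_sqrt_div_log_atTop.const_mul_atTop
    hδ).eventually (eventually_ge_atTop (|psiErrorPrimitive X| +
      ∫ t in (2 : ℝ)..X, psiError t * (1 / (t * Real.log t ^ 2))))] with x hx hlarge
  have hx1 : 1 < x := hX1.trans_le hx
  rw [← intervalIntegral.integral_add_adjacent_intervals
    (intervalIntegrable_psiError_div one_lt_two hX1) (intervalIntegrable_psiError_div hX1 hx1)]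
  have h := integral_psiError_div_le hδ.le (le_max_right _ _) hx
    fun y hy => hX₀ y ((le_max_left _ _).trans hy)
  linarith

theorem eventually_le_Li_psi
    (hP : ∀ ε : ℝ, 0 < ε →
      ∀ᶠ x : ℝ in atTop, |psiErrorPrimitive x| ≤ ε * (x * √x * Real.log x)) {ε : ℝ} (hε : 0 < ε) :
    ∀ᶠ x : ℝ in atTop, Li x + (Chebyshev.psi x - x) / Real.log x - ε * (√x / Real.log x) ≤
      Li (Chebyshev.psi x) := by
  obtain ⟨δ, hδ, rfl⟩ : ∃ δ : ℝ, 0 < δ ∧ 32 * δ = ε := ⟨ε / 32, by positivity, by ring⟩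
  filter_upwards [eventually_psiError_sq_le hP hδ, eventually_ge_atTop 100,
    eventually_log_le_mul_sqrt (c := 1 / (32 * δ)) (by positivity),
    tendsto_sqrt_div_log_atTop.eventually (eventually_ge_atTop (1 / (2 * δ)))] with x he hx hlog hs
  have hx0 : 0 < x := by linarith
  have hs0 : 0 < √x := Real.sqrt_pos.2 hx0
  have hsx : √x * √x = x := Real.mul_self_sqrt hx0.le
  have hL : 1 ≤ Real.log x := (Real.le_log_iff_exp_le hx0).2 (by linarith [Real.exp_one_lt_d9])
  have hlog' : δ * Real.log x ≤ √x / 32 := by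
    calc δ * Real.log x ≤ δ * (1 / (32 * δ) * √x) := by gcongr
      _ = _ := by field_simp
  have hE : (Chebyshev.psi x - x) ^ 2 ≤ 2 * (δ * (x * √x * Real.log x)) + 2 := by
    have : Chebyshev.psi x - x = psiError x - 1 := by rw [psiError]; ring
    rw [this]
    nlinarith [sq_nonneg (psiError x + 1)]
  have hsmall : 2 * (δ * (x * √x * Real.log x)) + 2 ≤ (x / 2) ^ 2 := by
    have h1 : x * √x * (δ * Real.log x) ≤ x * √x * (√x / 32) := by gcongr
    have h2 : x * √x * (√x / 32) = x ^ 2 / 32 := by linear_combination (x / 32) * hsx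
    nlinarith
  have hle := abs_le_of_sq_le_sq' (hE.trans hsmall) (by positivity)
  have hLi := abs_le.1 (abs_Li_sub_sub_div_log_le (a := x / 2) (x := x) (y := Chebyshev.psi x)
    (by linarith) (by linarith) (by linarith))
  have hLa : Real.log x / 2 ≤ Real.log (x / 2) := by
    rw [← Real.log_sqrt hx0.le]
    refine Real.log_le_log hs0 (Real.sqrt_le_iff.2 ⟨by positivity, by nlinarith⟩)
  have hq : (Chebyshev.psi x - x) ^ 2 / (x / 2 * Real.log (x / 2) ^ 2) ≤
      32 * δ * (√x / Real.log x) := by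
    have h2 : 2 ≤ 2 * (δ * (x * √x * Real.log x)) := by
      rw [div_le_div_iff₀ (by positivity) (by positivity)] at hs
      have h3 := mul_le_mul_of_nonneg_right hs (by positivity : 0 ≤ x * Real.log x)
      have h4 : 100 * 1 ≤ x * (Real.log x * Real.log x) := by
        gcongr
        nlinarith
      linarith
    calc (Chebyshev.psi x - x) ^ 2 / (x / 2 * Real.log (x / 2) ^ 2)
        ≤ (4 * (δ * (x * √x * Real.log x))) / (x / 2 * (Real.log x / 2) ^ 2) := by
          gcongr
          linarith
      _ = 32 * δ * (√x / Real.log x) := by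
          field_simp
          norm_num
  linarith [hLi.1]

theorem eventually_primeCounting_lt_Li_psi
    (h : ∀ ρ : ℂ, riemannZeta ρ = 0 → 0 < ρ.re → ρ.re < 1 → ρ.re = 1 / 2) :
    ∀ᶠ x : ℝ in atTop, 0 < Li (Chebyshev.psi x) - Nat.primeCounting ⌊x⌋₊ := by
  have hP : ∀ ε : ℝ, 0 < ε →
      ∀ᶠ x : ℝ in atTop, |psiErrorPrimitive x| ≤ ε * (x * √x * Real.log x) :=
    fun ε hε => eventually_abs_psiErrorPrimitive_le h hε
  filter_upwards [eventually_le_Li_psi hP (ε := 1 / 8) (by norm_num),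
    eventually_integral_psiError_div_le hP (ε := 1 / 8) (by norm_num),
    eventually_sqrt_div_two_le_psi_sub_theta, eventually_ge_atTop 2,
    tendsto_sqrt_div_log_atTop.eventually (eventually_gt_atTop (4 * (2 / Real.log 2)))]
    with x h1 h2 h3 hx h4
  have h5 := le_Li_add_sub_primeCounting hx
  have hL : 0 < Real.log x := Real.log_pos (by linarith)
  have h6 : √x / 2 / Real.log x ≤ (Chebyshev.psi x - Chebyshev.theta x) / Real.log x := by gcongr
  rw [div_right_comm] at h6
  linarith

theorem Li_theta_le_Li_psi {x : ℝ} (hx : 2 ≤ x) :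
    Li (Chebyshev.theta x) ≤ Li (Chebyshev.psi x) := by
  rcases lt_or_ge x 3 with h3 | h3
  · have hfl : ⌊x⌋₊ = 2 := (Nat.floor_eq_iff (by linarith)).2 ⟨by exact_mod_cast hx, by
      norm_num; exact h3⟩
    have : Chebyshev.theta x = Chebyshev.psi x := by
      have e : Finset.Ioc 0 2 = {1, 2} := by decide
      rw [Chebyshev.theta, Chebyshev.psi, hfl, e, Finset.sum_filter,
        Finset.sum_pair (by norm_num), Finset.sum_pair (by norm_num),
        ArithmeticFunction.vonMangoldt_apply_prime Nat.prime_two,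
        ArithmeticFunction.vonMangoldt_apply_one]
      simp [Nat.prime_two, Nat.not_prime_one]
    rw [this]
  · refine Li_mono ?_ (Chebyshev.theta_le_psi x)
    have h1 : Chebyshev.theta 3 = Real.log 2 + Real.log 3 := by
      have e : (Finset.Ioc 0 3).filter Nat.Prime = {2, 3} := by decide
      have hfl : ⌊(3 : ℝ)⌋₊ = 3 := Nat.floor_ofNat 3
      rw [Chebyshev.theta, hfl, e, Finset.sum_pair (by norm_num)]
      norm_num
    have h2 := Chebyshev.theta_mono h3
    have h4 : 1 ≤ Real.log 3 :=
      (Real.le_log_iff_exp_le (by norm_num)).2 (by linarith [Real.exp_one_lt_d9])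
    linarith [Real.log_pos one_lt_two]

theorem chebyshevTheta_eq_theta (x : ℝ) : chebyshevTheta x = Chebyshev.theta x := by
  rw [Chebyshev.theta_eq_sum_Icc]
  rfl

theorem chebyshevPsi_eq_psi (x : ℝ) : chebyshevPsi x = Chebyshev.psi x := by
  rw [chebyshevPsi, Chebyshev.psi, ← Finset.Icc_add_one_left_eq_Ioc, zero_add]

end

/-- If RH holds, then Li(θ(x)) ≤ Li(ψ(x)) for all x ≥ 2, and consequently
Li(ψ(x)) − π(x) > 0 for all sufficiently large x. -/
theorem li_theta_le_li_psi_and_eventually_pos_of_RH :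
    (∀ ρ : ℂ, riemannZeta ρ = 0 → 0 < ρ.re → ρ.re < 1 → ρ.re = 1 / 2) →
    (∀ x : ℝ, 2 ≤ x → Li (chebyshevTheta x) ≤ Li (chebyshevPsi x)) ∧
    ∀ᶠ x : ℝ in atTop, 0 < Li (chebyshevPsi x) - primePi x := by
  intro h
  refine ⟨fun x hx => ?_, ?_⟩
  · rw [chebyshevTheta_eq_theta, chebyshevPsi_eq_psi]
    exact Li_theta_le_Li_psi hx
  · filter_upwards [eventually_primeCounting_lt_Li_psi h] with x hx
    rwa [chebyshevPsi_eq_psi, primePi]
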